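/- arXiv:1707.08096 — 4 statements merged into one kernel-verified Lean document; each statement's English description precedes it below -/
import Mathlib

section
/- Let n ≥ 1, let g : ℝⁿ → ℂ be a smooth compactly supported function and let f : ℝⁿ → ℝ be smooth. Assume every critical point x₀ of f lying in supp g (i.e., every x₀ ∈ supp g with the derivative of f vanishing at x₀) is nondegenerate, meaning the Hessian matrix f''(x₀) = (∂²f/∂xᵢ∂xⱼ(x₀)) is invertible. Then the set S of critical points of f in supp g is finite, and as k → +∞ one has ∫_{ℝⁿ} g(x) e^{i k f(x)} dx = Σ_{x₀ ∈ S} e^{i k f(x₀)} (2π/k)^{n/2} |det f''(x₀)|^{-1/2} e^{(iπ/4)·sign(f''(x₀))} g(x₀) + O(k^{-n/2-1}). -/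
open MeasureTheory Filter Asymptotics

noncomputable section

/-- The Hessian matrix `(∂²f/∂xᵢ∂xⱼ)(x₀)` of a function `f : ℝⁿ → ℝ`. -/
def hessianMatrix {n : ℕ} (f : (Fin n → ℝ) → ℝ) (x₀ : Fin n → ℝ) :
    Matrix (Fin n) (Fin n) ℝ :=
  Matrix.of fun i j => iteratedFDeriv ℝ 2 f x₀ ![Pi.single i 1, Pi.single j 1]

/-- The signature (number of positive eigenvalues minus the number of negative eigenvalues,
with multiplicity) of a real matrix `A`, computed via the symmetrization `A + Aᵀ`;
for a symmetric matrix `A` (such as a Hessian) this is the usual signature of `A`. -/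
def matrixSignature {n : ℕ} (A : Matrix (Fin n) (Fin n) ℝ) : ℤ :=
  ((Finset.univ.filter (fun i =>
      0 < (Matrix.isHermitian_add_transpose_self A).eigenvalues i)).card : ℤ) -
    ((Finset.univ.filter (fun i =>
      (Matrix.isHermitian_add_transpose_self A).eigenvalues i < 0)).card : ℤ)

open scoped Topology ContDiff Manifold

universe u

theorem contDiff_nat_intervalIntegral_param {E : Type u} [NormedAddCommGroup E] [NormedSpace ℝ E]
    [FiniteDimensional ℝ E] (m : ℕ) :
    ∀ {G : Type u} [NormedAddCommGroup G] [NormedSpace ℝ G] [CompleteSpace G] {h : ℝ × E → G},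
      ContDiff ℝ ∞ h → ContDiff ℝ m (fun x => ∫ t in (0 : ℝ)..1, h (t, x)) := by
  induction m with
  | zero =>
    intro G _ _ _ h hh
    have hc := hh.continuous
    refine contDiff_zero.2 ?_
    exact intervalIntegral.continuous_parametric_intervalIntegral_of_continuous'
      (f := fun x t => h (t, x)) (by fun_prop) 0 1
  | succ m ih =>
    intro G _ _ _ h hh
    have hc := hh.continuous
    set h' : ℝ × E → (E →L[ℝ] G) :=
      fun p => (fderiv ℝ h p).comp (ContinuousLinearMap.inr ℝ ℝ E) with hh'
    have hsm : ContDiff ℝ ∞ h' := (hh.fderiv_right (by simp)).clm_comp contDiff_const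
    have hc' := hsm.continuous
    have hd : ∀ t x, HasFDerivAt (fun y => h (t, y)) (h' (t, x)) x := fun t x =>
      ((hh.differentiable (by simp)) (t, x)).hasFDerivAt.comp x (hasFDerivAt_prodMk_right t x)
    refine (contDiff_succ_iff_hasFDerivAt (n := m)).2
      ⟨fun x => ∫ t in (0 : ℝ)..1, h' (t, x), ih hsm, fun x₀ => ?_⟩
    obtain ⟨C, hC⟩ := ((isCompact_Icc (a := (0 : ℝ)) (b := 1)).prod
      (isCompact_closedBall x₀ 1)).exists_bound_of_continuousOn hc'.continuousOn
    refine (intervalIntegral.hasFDerivAt_integral_of_dominated_of_fderiv_le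
      (F := fun x t => h (t, x)) (F' := fun x t => h' (t, x)) (bound := fun _ => C)
      (Metric.ball_mem_nhds x₀ one_pos) ?_ ?_ ?_ ?_ ?_ ?_)
    · exact Eventually.of_forall fun x => Continuous.aestronglyMeasurable (by fun_prop)
    · exact Continuous.intervalIntegrable (by fun_prop) _ _
    · exact Continuous.aestronglyMeasurable (by fun_prop)
    · refine Eventually.of_forall fun t ht x hx => hC (t, x) ⟨?_, Metric.ball_subset_closedBall hx⟩
      rw [Set.uIoc_of_le zero_le_one] at ht
      exact ⟨ht.1.le, ht.2⟩
    · exact intervalIntegrable_const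
    · exact Eventually.of_forall fun t _ x _ => hd t x

/-- **Hadamard's lemma**. -/
theorem exists_contDiff_eq_add_apply_sub {E : Type u} [NormedAddCommGroup E]
    [NormedSpace ℝ E] [FiniteDimensional ℝ E] {G : Type u} [NormedAddCommGroup G] [NormedSpace ℝ G]
    [CompleteSpace G] {F : E → G} (hF : ContDiff ℝ ∞ F) (s : E) :
    ∃ Φ : E → (E →L[ℝ] G), ContDiff ℝ ∞ Φ ∧ Φ s = fderiv ℝ F s ∧
      ∀ x, F x = F s + Φ x (x - s) := by
  have hF' : ContDiff ℝ ∞ (fderiv ℝ F) := hF.fderiv_right (by simp)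
  have hk : ContDiff ℝ ∞ (fun p : ℝ × E => fderiv ℝ F (s + p.1 • (p.2 - s))) :=
    hF'.comp (by fun_prop)
  refine ⟨fun x => ∫ t in (0 : ℝ)..1, fderiv ℝ F (s + t • (x - s)), ?_, ?_, fun x => ?_⟩
  · exact contDiff_infty.2 fun m => contDiff_nat_intervalIntegral_param m hk
  · simp
  · have hcont : Continuous fun t : ℝ => fderiv ℝ F (s + t • (x - s)) :=
      hF'.continuous.comp (by fun_prop)
    have hder : ∀ t : ℝ, HasDerivAt (fun t : ℝ => F (s + t • (x - s)))
        (fderiv ℝ F (s + t • (x - s)) (x - s)) t := fun t => by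
      refine ((hF.differentiable (by simp)) _).hasFDerivAt.comp_hasDerivAt t ?_
      simpa using ((hasDerivAt_id t).smul_const (x - s)).const_add s
    have := intervalIntegral.integral_eq_sub_of_hasDerivAt (a := 0) (b := 1)
      (fun t _ => hder t) (Continuous.intervalIntegrable (by fun_prop) _ _)
    rw [ContinuousLinearMap.intervalIntegral_apply (hcont.intervalIntegrable _ _), this]
    simp

/-- Smooth functions on the line vanishing near `0` and equal to a multiple of a nonpositive power
of the variable near infinity. -/
structure IsFlatTail (h : ℝ → ℂ) : Prop where
  contDiff : ContDiff ℝ ∞ h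
  eventually_eq_zero : ∀ᶠ t in 𝓝 0, h t = 0
  tail : ∃ (R : ℝ) (C : ℂ) (m : ℕ), 0 < R ∧ ∀ t : ℝ, R < |t| → h t = C * ((t : ℂ)⁻¹) ^ m

namespace IsFlatTail

variable {h : ℝ → ℂ}

theorem exists_bound (hh : IsFlatTail h) : ∃ B, ∀ t, ‖h t‖ ≤ B := by
  obtain ⟨R, C, m, hR, htail⟩ := hh.tail
  obtain ⟨B, hB⟩ := (isCompact_Icc (a := -R) (b := R)).exists_bound_of_continuousOn
    hh.contDiff.continuous.continuousOn
  refine ⟨max B (‖C‖ * (R⁻¹) ^ m), fun t => ?_⟩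
  by_cases ht : |t| ≤ R
  · exact (hB t (abs_le.1 ht)).trans (le_max_left _ _)
  · push Not at ht
    refine le_trans ?_ (le_max_right _ _)
    rw [htail t ht, norm_mul, norm_pow, norm_inv, Complex.norm_real, Real.norm_eq_abs]
    gcongr

theorem div (hh : IsFlatTail h) : IsFlatTail (fun t => h t / t) := by
  refine ⟨contDiff_iff_contDiffAt.2 fun t => ?_, ?_, ?_⟩
  · by_cases ht : t = 0
    · subst ht
      refine (contDiffAt_const (c := (0 : ℂ))).congr_of_eventuallyEq ?_
      filter_upwards [hh.eventually_eq_zero] with t ht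
      simp [ht]
    · simp only [div_eq_mul_inv]
      exact hh.contDiff.contDiffAt.mul
        (Complex.ofRealCLM.contDiff.contDiffAt.inv (by simpa using ht))
  · filter_upwards [hh.eventually_eq_zero] with t ht
    simp [ht]
  · obtain ⟨R, C, m, hR, htail⟩ := hh.tail
    refine ⟨R, C, m + 1, hR, fun t ht => ?_⟩
    rw [htail t ht, pow_succ, div_eq_mul_inv, mul_assoc]

theorem deriv (hh : IsFlatTail h) : IsFlatTail (deriv h) := by
  refine ⟨(contDiff_infty_iff_deriv.1 hh.contDiff).2, ?_, ?_⟩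
  · filter_upwards [hh.eventually_eq_zero.eventually_nhds] with t ht
    rw [EventuallyEq.deriv_eq (f := fun _ => (0 : ℂ)) ht]
    simp
  · obtain ⟨R, C, m, hR, htail⟩ := hh.tail
    refine ⟨R, -(m * C), m + 1, hR, fun t ht => ?_⟩
    have ht0 : (t : ℂ) ≠ 0 := by
      rintro h0
      rw [Complex.ofReal_eq_zero] at h0
      simp only [h0, abs_zero] at ht
      exact lt_asymm hR ht
    have hev : h =ᶠ[𝓝 t] fun t : ℝ => C * ((t : ℂ)⁻¹) ^ m := by
      filter_upwards [(isOpen_lt continuous_const continuous_abs).mem_nhds ht] with s hs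
      exact htail s hs
    rw [hev.deriv_eq]
    have hd := ((((hasDerivAt_id (t : ℂ)).inv ht0).pow m).const_mul C).comp_ofReal
    refine (hd.deriv).trans ?_
    cases m with
    | zero => simp
    | succ m =>
      simp only [id, Nat.add_sub_cancel, Pi.inv_apply]
      rw [pow_succ ((t : ℂ)⁻¹) (m + 1), pow_succ ((t : ℂ)⁻¹) m]
      field_simp

theorem integrable (hh : IsFlatTail h) {σ : ℂ} (hσ : 0 < σ.re) :
    Integrable (fun t : ℝ => h t * Complex.exp (-σ * (t : ℂ) ^ 2)) := by
  obtain ⟨B, hB⟩ := hh.exists_bound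
  exact (integrable_cexp_neg_mul_sq hσ).bdd_mul
    hh.contDiff.continuous.aestronglyMeasurable (Eventually.of_forall hB)

theorem integral_eq (hh : IsFlatTail h) {σ : ℂ} (hσ : 0 < σ.re) :
    ∫ t : ℝ, h t * Complex.exp (-σ * (t : ℂ) ^ 2) =
      (2 * σ)⁻¹ * ∫ t : ℝ, _root_.deriv (fun t => h t / t) t * Complex.exp (-σ * (t : ℂ) ^ 2) := by
  have hσ0 : σ ≠ 0 := by rintro rfl; simp at hσ
  have hexp (t : ℝ) : HasDerivAt (fun t : ℝ => Complex.exp (-σ * (t : ℂ) ^ 2))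
      (-(2 * σ) * (t * Complex.exp (-σ * (t : ℂ) ^ 2))) t := by
    convert (((hasDerivAt_pow 2 (t : ℂ)).const_mul (-σ)).cexp).comp_ofReal using 1
    push_cast
    ring
  have hmul (t : ℝ) : h t / t * (-(2 * σ) * (t * Complex.exp (-σ * (t : ℂ) ^ 2))) =
      -(2 * σ) * (h t * Complex.exp (-σ * (t : ℂ) ^ 2)) := by
    by_cases ht : t = 0
    · simp [ht, hh.eventually_eq_zero.self_of_nhds]
    · have : (t : ℂ) ≠ 0 := by simpa using ht
      field_simp
  have key := integral_mul_deriv_eq_deriv_mul_of_integrable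
    (u := fun t : ℝ => h t / t) (u' := _root_.deriv (fun t : ℝ => h t / t))
    (v := fun t : ℝ => Complex.exp (-σ * (t : ℂ) ^ 2))
    (v' := fun t : ℝ => -(2 * σ) * (t * Complex.exp (-σ * (t : ℂ) ^ 2)))
    (fun t _ => ((hh.div.contDiff.differentiable (by simp)) t).hasDerivAt) (fun t _ => hexp t)
    (by
      refine ((hh.integrable hσ).const_mul (-(2 * σ))).congr (Eventually.of_forall fun t => ?_)
      exact (hmul t).symm)
    (hh.div.deriv.integrable hσ) (hh.div.integrable hσ)
  simp only [hmul] at key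
  rw [integral_const_mul] at key
  rw [inv_mul_eq_div, eq_div_iff (by simpa using hσ0)]
  linear_combination -key

theorem exists_norm_integral_le (hh : IsFlatTail h) :
    ∃ B, ∀ σ : ℂ, σ.re = 1 →
      ‖∫ t : ℝ, h t * Complex.exp (-σ * (t : ℂ) ^ 2)‖ ≤ B * (‖σ‖ ^ 2)⁻¹ := by
  have hh₂ := hh.div.deriv.div.deriv
  obtain ⟨B, hB⟩ := hh₂.exists_bound
  refine ⟨4⁻¹ * (B * ∫ t : ℝ, Real.exp (-1 * t ^ 2)), fun σ hσ => ?_⟩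
  have hσ' : 0 < σ.re := by simp [hσ]
  rw [hh.integral_eq hσ', hh.div.deriv.integral_eq hσ', ← mul_assoc, norm_mul]
  have h1 : ‖(2 * σ)⁻¹ * (2 * σ)⁻¹‖ = 4⁻¹ * (‖σ‖ ^ 2)⁻¹ := by
    simp only [norm_mul, norm_inv, Complex.norm_ofNat, mul_inv]
    ring
  rw [h1]
  have h2 : ‖∫ t : ℝ, _root_.deriv (fun t : ℝ => _root_.deriv (fun t => h t / t) t / t) t *
      Complex.exp (-σ * (t : ℂ) ^ 2)‖ ≤ B * ∫ t : ℝ, Real.exp (-1 * t ^ 2) := by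
    rw [← integral_const_mul]
    refine norm_integral_le_of_norm_le ((integrable_exp_neg_mul_sq one_pos).const_mul B)
      (Eventually.of_forall fun t => ?_)
    rw [norm_mul, norm_cexp_neg_mul_sq, hσ]
    gcongr
    exact hB t
  calc _ ≤ 4⁻¹ * (‖σ‖ ^ 2)⁻¹ * (B * ∫ t : ℝ, Real.exp (-1 * t ^ 2)) := by gcongr
    _ = _ := by ring

end IsFlatTail

theorem Complex.re_cpow_half_nonneg (z : ℂ) : 0 ≤ (z ^ (1 / 2 : ℂ)).re := by
  by_cases hz : z = 0
  · simp [hz]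
  rw [Complex.cpow_def_of_ne_zero hz, Complex.exp_re]
  have him : (Complex.log z * (1 / 2)).im = z.arg / 2 := by
    have : Complex.log z * (1 / 2) = Complex.log z / ((2 : ℝ) : ℂ) := by push_cast; ring
    rw [this, Complex.div_ofReal_im, Complex.log_im]
  rw [him]
  have := Complex.neg_pi_lt_arg z
  have := Complex.arg_le_pi z
  exact mul_nonneg (Real.exp_pos _).le (Real.cos_nonneg_of_mem_Icc ⟨by linarith, by linarith⟩)

/-- The value of the Fresnel-type integral `∫ exp (i a t²) dt`. -/
noncomputable def fresnelValue (a : ℝ) : ℂ :=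
  (Real.sqrt (Real.pi / |a|) : ℂ) * Complex.exp (Complex.I * Real.pi / 4 * (Real.sign a : ℝ))

theorem fresnelValue_sq {a : ℝ} (ha : a ≠ 0) :
    fresnelValue a ^ 2 = Complex.I * Real.pi / a := by
  have hexp : Complex.exp (Complex.I * Real.pi / 4 * (Real.sign a : ℝ)) ^ 2 =
      Complex.I * (Real.sign a : ℝ) := by
    rw [← Complex.exp_nat_mul]
    rcases ha.lt_or_gt with h | h
    · rw [Real.sign_of_neg h]
      have : ((2 : ℕ) : ℂ) * (Complex.I * Real.pi / 4 * ((-1 : ℝ) : ℂ)) =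
        -(Real.pi / 2 * Complex.I) := by push_cast; ring
      rw [this, Complex.exp_neg, Complex.exp_pi_div_two_mul_I]
      simp
    · rw [Real.sign_of_pos h]
      have : ((2 : ℕ) : ℂ) * (Complex.I * Real.pi / 4 * ((1 : ℝ) : ℂ)) =
        (Real.pi / 2 * Complex.I) := by push_cast; ring
      rw [this, Complex.exp_pi_div_two_mul_I]
      simp
  have hs : ((Real.sqrt (Real.pi / |a|) : ℝ) : ℂ) ^ 2 = ((Real.pi / |a| : ℝ) : ℂ) := by
    rw [← Complex.ofReal_pow, Real.sq_sqrt (by positivity)]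
  rw [fresnelValue, mul_pow, hexp, hs]
  have ha' : (a : ℂ) ≠ 0 := by simpa using ha
  rcases ha.lt_or_gt with h | h
  · rw [Real.sign_of_neg h, abs_of_neg h]; push_cast; field_simp
  · rw [Real.sign_of_pos h, abs_of_pos h]; push_cast; field_simp

theorem fresnelValue_re {a : ℝ} (ha : a ≠ 0) :
    (fresnelValue a).re = Real.sqrt (Real.pi / |a|) * (Real.sqrt 2 / 2) := by
  rw [fresnelValue, Complex.re_ofReal_mul]
  congr 1
  have : Complex.I * Real.pi / 4 * (Real.sign a : ℝ) =
      ((Real.pi / 4 * Real.sign a : ℝ) : ℂ) * Complex.I := by push_cast; ring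
  rw [this, Complex.exp_ofReal_mul_I_re]
  rcases ha.lt_or_gt with h | h
  · simp [Real.sign_of_neg h]
  · simp [Real.sign_of_pos h]

theorem norm_gaussian_sub_fresnelValue_le {a : ℝ} (ha : a ≠ 0) :
    ‖(Real.pi / (1 - Complex.I * a)) ^ (1 / 2 : ℂ) - fresnelValue a‖ ≤
      Real.sqrt (2 * Real.pi) * |a| ^ (-(3 : ℝ) / 2) := by
  set z : ℂ := (Real.pi / (1 - Complex.I * a)) ^ (1 / 2 : ℂ) with hz
  set w := fresnelValue a with hw
  have hapos : 0 < |a| := abs_pos.2 ha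
  have ha' : (a : ℂ) ≠ 0 := by simpa using ha
  have h1 : (1 - Complex.I * a : ℂ) ≠ 0 := by
    intro h
    have := congrArg Complex.re h
    simp at this
  have hz2 : z ^ 2 = Real.pi / (1 - Complex.I * a) := by
    rw [hz, ← Complex.cpow_nat_mul]; norm_num
  have hmul : (z - w) * (z + w) = -Complex.I * Real.pi / (a * (1 - Complex.I * a)) := by
    have : (z - w) * (z + w) = z ^ 2 - w ^ 2 := by ring
    rw [this, hz2, fresnelValue_sq ha]
    field_simp
    ring_nf
    simp
  have hge : |a| ≤ ‖(1 - Complex.I * a : ℂ)‖ := by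
    have := Complex.abs_im_le_norm (1 - Complex.I * a : ℂ)
    simpa using this
  have hnorm : ‖z - w‖ * ‖z + w‖ ≤ Real.pi / |a| ^ 2 := by
    rw [← norm_mul, hmul, norm_div, norm_mul, norm_mul, norm_neg, Complex.norm_I, one_mul,
      Complex.norm_real, Complex.norm_real, Real.norm_eq_abs, Real.norm_eq_abs,
      abs_of_pos Real.pi_pos, sq]
    gcongr
  have hlow : Real.sqrt (Real.pi / |a|) * (Real.sqrt 2 / 2) ≤ ‖z + w‖ := by
    refine le_trans ?_ (Complex.re_le_norm _)
    rw [Complex.add_re, ← fresnelValue_re ha]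
    have := Complex.re_cpow_half_nonneg (Real.pi / (1 - Complex.I * a))
    linarith
  have hc : 0 < Real.sqrt (Real.pi / |a|) * (Real.sqrt 2 / 2) := by positivity
  have hval : Real.sqrt (2 * Real.pi) * |a| ^ (-(3 : ℝ) / 2) *
      (Real.sqrt (Real.pi / |a|) * (Real.sqrt 2 / 2)) = Real.pi / |a| ^ 2 := by
    rw [Real.sqrt_mul (by norm_num), Real.sqrt_div Real.pi_pos.le]
    have e1 : |a| ^ (-(3 : ℝ) / 2) = (|a| * Real.sqrt |a|)⁻¹ := by
      rw [Real.sqrt_eq_rpow, neg_div, Real.rpow_neg hapos.le]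
      congr 1
      nth_rewrite 2 [← Real.rpow_one |a|]
      rw [← Real.rpow_add hapos]
      norm_num
    rw [e1]
    have s1 := Real.mul_self_sqrt hapos.le
    have s2 := Real.mul_self_sqrt (show (0:ℝ) ≤ 2 by norm_num)
    have s3 := Real.mul_self_sqrt Real.pi_pos.le
    have hs : Real.sqrt |a| ≠ 0 := by positivity
    field_simp
    rw [show Real.sqrt 2 ^ 2 = 2 by rw [sq, s2], show Real.sqrt Real.pi ^ 2 = Real.pi by rw [sq, s3],
      show Real.sqrt |a| ^ 2 = |a| by rw [sq, s1]]
    ring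
  refine le_of_mul_le_mul_right ?_ hc
  rw [hval]
  exact le_trans (by gcongr) hnorm

/-- One-dimensional stationary phase for the phase `l t²` and a suitable cutoff. -/
theorem exists_cutoff_integral_sub_fresnelValue {r : ℝ} (hr : 0 < r) :
    ∃ b : ℝ → ℝ, ContDiff ℝ ∞ b ∧ b 0 = 1 ∧ (∀ t, r ≤ |t| → b t = 0) ∧
      ∀ l : ℝ, l ≠ 0 →
        (fun k : ℝ => (∫ t : ℝ, (b t : ℂ) * Complex.exp (Complex.I * k * (l * t ^ 2 : ℝ))) -
          fresnelValue (k * l)) =O[atTop] fun k : ℝ => k ^ (-(3 : ℝ) / 2) := by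
  let ψ : ContDiffBump (0 : ℝ) := ⟨r / 2, r, by positivity, by linarith⟩
  have hψ0 : ∀ t, r ≤ |t| → ψ t = 0 := fun t ht => ψ.zero_of_le_dist (by simpa using ht)
  have hflat : IsFlatTail (fun t => 1 - (ψ t : ℂ)) := by
    refine ⟨contDiff_const.sub (Complex.ofRealCLM.contDiff.comp ψ.contDiff), ?_,
      r, 1, 0, hr, fun t ht => by simp [hψ0 t ht.le]⟩
    filter_upwards [ψ.eventuallyEq_one] with t ht
    simp [ht]
  obtain ⟨B, hB⟩ := hflat.exists_norm_integral_le
  refine ⟨fun t => ψ t * Real.exp (-t ^ 2), ψ.contDiff.mul (by fun_prop), ?_,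
    fun t ht => by simp [hψ0 t ht], fun l hl => ?_⟩
  · simp [ψ.eventuallyEq_one.self_of_nhds]
  have hsplit : ∀ a : ℝ, (∫ t : ℝ, ((ψ t * Real.exp (-t ^ 2) : ℝ) : ℂ) *
        Complex.exp (Complex.I * (a * t ^ 2 : ℝ))) =
      (Real.pi / (1 - Complex.I * a)) ^ (1 / 2 : ℂ) -
        ∫ t : ℝ, (1 - (ψ t : ℂ)) * Complex.exp (-(1 - Complex.I * a) * (t : ℂ) ^ 2) := by
    intro a
    have hre : 0 < (1 - Complex.I * a : ℂ).re := by simp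
    rw [← integral_gaussian_complex hre,
      ← integral_sub (integrable_cexp_neg_mul_sq hre) (hflat.integrable hre)]
    refine integral_congr_ae (Eventually.of_forall fun t => ?_)
    have : Complex.exp (-(1 - Complex.I * a) * (t : ℂ) ^ 2) =
        Complex.exp (-(t : ℂ) ^ 2) * Complex.exp (Complex.I * (a * t ^ 2 : ℝ)) := by
      rw [← Complex.exp_add]; congr 1; push_cast; ring
    simp only [this]
    push_cast
    ring
  have hB0 : 0 ≤ B := by
    have := (norm_nonneg _).trans (hB 1 (by simp))
    simpa using this
  refine IsBigO.of_bound ((Real.sqrt (2 * Real.pi)) * |l| ^ (-(3 : ℝ) / 2) + B * (|l| ^ 2)⁻¹) ?_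
  filter_upwards [eventually_ge_atTop 1] with k hk
  have hk0 : 0 < k := by linarith
  have hkl : k * l ≠ 0 := mul_ne_zero hk0.ne' hl
  have hl0 : 0 < |l| := abs_pos.2 hl
  have hrew : (∫ t : ℝ, ((ψ t * Real.exp (-t ^ 2) : ℝ) : ℂ) *
        Complex.exp (Complex.I * k * (l * t ^ 2 : ℝ))) = ∫ t : ℝ,
        ((ψ t * Real.exp (-t ^ 2) : ℝ) : ℂ) * Complex.exp (Complex.I * (k * l * t ^ 2 : ℝ)) := by
    congr 1; funext t; congr 2; push_cast; ring
  rw [hrew, hsplit (k * l)]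
  have h1 := norm_gaussian_sub_fresnelValue_le hkl
  have h2 := hB (1 - Complex.I * (k * l : ℝ)) (by simp)
  have h3 : (‖(1 - Complex.I * (k * l : ℝ) : ℂ)‖ ^ 2)⁻¹ ≤ (|l| ^ 2)⁻¹ * k ^ (-(3 : ℝ) / 2) := by
    have hge : |k * l| ≤ ‖(1 - Complex.I * (k * l : ℝ) : ℂ)‖ := by
      have := Complex.abs_im_le_norm (1 - Complex.I * (k * l : ℝ) : ℂ)
      simpa using this
    calc (‖(1 - Complex.I * (k * l : ℝ) : ℂ)‖ ^ 2)⁻¹ ≤ (|k * l| ^ 2)⁻¹ := by gcongr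
      _ = (|l| ^ 2)⁻¹ * k ^ (-2 : ℝ) := by
        rw [abs_mul, abs_of_pos hk0, Real.rpow_neg hk0.le, mul_pow, mul_inv, mul_comm]
        norm_num
      _ ≤ _ := by
        gcongr
        norm_num
  have h4 : |k * l| ^ (-(3 : ℝ) / 2) = |l| ^ (-(3 : ℝ) / 2) * k ^ (-(3 : ℝ) / 2) := by
    rw [abs_mul, abs_of_pos hk0, Real.mul_rpow hk0.le hl0.le, mul_comm]
  rw [h4] at h1
  rw [Real.norm_of_nonneg (by positivity : 0 ≤ k ^ (-(3 : ℝ) / 2)), sub_right_comm]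
  refine (norm_sub_le _ _).trans ?_
  refine (add_le_add h1 (h2.trans (mul_le_mul_of_nonneg_left h3 hB0))).trans (le_of_eq ?_)
  ring

theorem Asymptotics.IsBigO.prod_sub_prod_rpow {ι : Type*} (s : Finset ι) {F c : ι → ℝ → ℂ}
    (hF : ∀ i ∈ s, (fun k => F i k - c i k) =O[atTop] fun k : ℝ => k ^ (-(3 : ℝ) / 2))
    (hc : ∀ i ∈ s, c i =O[atTop] fun k : ℝ => k ^ (-(1 : ℝ) / 2)) :
    ((fun k => ∏ i ∈ s, c i k) =O[atTop] fun k : ℝ => k ^ (-(s.card : ℝ) / 2)) ∧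
      (fun k => ∏ i ∈ s, F i k - ∏ i ∈ s, c i k) =O[atTop]
        fun k : ℝ => k ^ (-(s.card : ℝ) / 2 - 1) := by
  classical
  induction s using Finset.induction_on with
  | empty => exact ⟨by simpa using isBoundedUnder_const, by simpa using isBigO_zero _ _⟩
  | insert i s his ih =>
    obtain ⟨ih₁, ih₂⟩ := ih (fun j hj => hF j (Finset.mem_insert_of_mem hj))
      (fun j hj => hc j (Finset.mem_insert_of_mem hj))
    have hFi := hF i (Finset.mem_insert_self i s)
    have hci := hc i (Finset.mem_insert_self i s)
    simp only [Finset.prod_insert his, Finset.card_insert_of_notMem his]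
    have hpow (a b c : ℝ) (h : a + b = c) :
        (fun k : ℝ => k ^ a * k ^ b) =ᶠ[atTop] fun k => k ^ c := by
      filter_upwards [eventually_gt_atTop 0] with k hk
      rw [← Real.rpow_add hk, h]
    refine ⟨(hci.mul ih₁).trans_eventuallyEq (hpow _ _ _ (by push_cast; ring)), ?_⟩
    have hFc : F i =O[atTop] fun k : ℝ => k ^ (-(1 : ℝ) / 2) := by
      have : (fun k : ℝ => k ^ (-(3 : ℝ) / 2)) =O[atTop] fun k : ℝ => k ^ (-(1 : ℝ) / 2) := by
        refine IsBigO.of_bound 1 ?_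
        filter_upwards [eventually_ge_atTop 1] with k hk
        rw [one_mul, Real.norm_of_nonneg (by positivity), Real.norm_of_nonneg (by positivity)]
        gcongr
        norm_num
      simpa using (hFi.trans this).add hci
    have h1 := (hFc.mul ih₂).trans_eventuallyEq
      (hpow _ _ (-((s.card + 1 : ℕ) : ℝ) / 2 - 1) (by push_cast; ring))
    have h2 := (hFi.mul ih₁).trans_eventuallyEq
      (hpow _ _ (-((s.card + 1 : ℕ) : ℝ) / 2 - 1) (by push_cast; ring))
    refine (h1.add h2).congr_left fun k => ?_
    ring

theorem fresnelValue_mul_isBigO {l : ℝ} :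
    (fun k : ℝ => fresnelValue (k * l)) =O[atTop] fun k : ℝ => k ^ (-(1 : ℝ) / 2) := by
  refine IsBigO.of_bound (Real.sqrt (Real.pi / |l|)) ?_
  filter_upwards [eventually_gt_atTop 0] with k hk
  have : Complex.I * Real.pi / 4 * (Real.sign (k * l) : ℝ) =
      ((Real.pi / 4 * Real.sign (k * l) : ℝ) : ℂ) * Complex.I := by push_cast; ring
  rw [fresnelValue, norm_mul, this, Complex.norm_exp_ofReal_mul_I, Complex.norm_real,
    Real.norm_of_nonneg (Real.sqrt_nonneg _), Real.norm_of_nonneg (by positivity), abs_mul,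
    abs_of_pos hk, neg_div, Real.rpow_neg hk.le, ← Real.sqrt_eq_rpow, ← Real.sqrt_inv,
    ← Real.sqrt_mul (by positivity), mul_one]
  refine le_of_eq (congrArg _ ?_)
  rw [div_mul_eq_div_div_swap, div_eq_mul_inv (Real.pi / |l|)]

/-- Stationary phase for nondegenerate diagonal quadratic phases and a suitable cutoff. -/
theorem exists_cutoff_integral_sub_prod_fresnelValue (n : ℕ) {r : ℝ} (hr : 0 < r) :
    ∃ β : (Fin n → ℝ) → ℝ, ContDiff ℝ ∞ β ∧ β 0 = 1 ∧ (∀ y, β y ≠ 0 → ∀ i, |y i| < r) ∧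
      ∀ l : Fin n → ℝ, (∀ i, l i ≠ 0) →
        (fun k : ℝ => (∫ y : Fin n → ℝ,
            (β y : ℂ) * Complex.exp (Complex.I * k * (∑ i, l i * y i ^ 2 : ℝ))) -
          ∏ i, fresnelValue (k * l i)) =O[atTop] fun k : ℝ => k ^ (-(n : ℝ) / 2 - 1) := by
  obtain ⟨b, hb, hb0, hbsupp, hbO⟩ := exists_cutoff_integral_sub_fresnelValue hr
  refine ⟨fun y => ∏ i, b (y i), contDiff_prod fun i _ => hb.comp (contDiff_apply ℝ ℝ i),
    by simp [hb0], fun y hy i => ?_, fun l hl => ?_⟩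
  · by_contra! h
    exact hy (Finset.prod_eq_zero (Finset.mem_univ i) (hbsupp _ h))
  · have := (IsBigO.prod_sub_prod_rpow Finset.univ (fun i _ => hbO (l i) (hl i))
      (fun i _ => fresnelValue_mul_isBigO)).2
    rw [Finset.card_univ, Fintype.card_fin] at this
    refine this.congr_left fun k => ?_
    congr 1
    rw [← integral_fintype_prod_volume_eq_prod]
    refine integral_congr_ae (Eventually.of_forall fun y => ?_)
    simp only [Finset.prod_mul_distrib, ← Complex.exp_sum]
    push_cast
    rw [Finset.mul_sum]

/-- The oscillatory integral with phase `f`, amplitude `u` and frequency `k`. -/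
def oscillatoryIntegral {n : ℕ} (f : (Fin n → ℝ) → ℝ) (u : (Fin n → ℝ) → ℂ) (k : ℝ) : ℂ :=
  ∫ x : Fin n → ℝ, u x * Complex.exp (Complex.I * (k : ℂ) * (f x : ℂ))

/-- The vector of partial derivatives of a function on `ℝⁿ`. -/
def partials {n : ℕ} (f : (Fin n → ℝ) → ℝ) (x : Fin n → ℝ) : Fin n → ℝ :=
  fun i => fderiv ℝ f x (Pi.single i 1)

section

variable {n : ℕ} {f : (Fin n → ℝ) → ℝ}

theorem contDiff_partials (hf : ContDiff ℝ ∞ f) : ContDiff ℝ ∞ (partials f) :=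
  contDiff_pi.2 fun _ => (hf.fderiv_right (by simp)).clm_apply contDiff_const

theorem partials_eq_zero_iff {x : Fin n → ℝ} : partials f x = 0 ↔ fderiv ℝ f x = 0 := by
  refine ⟨fun h => ?_, fun h => by ext i; simp [partials, h]⟩
  refine ContinuousLinearMap.coe_injective ((Pi.basisFun ℝ (Fin n)).ext fun i => ?_)
  simpa [partials] using congrFun h i

theorem fderiv_partials_apply (hf : ContDiff ℝ ∞ f) (x v : Fin n → ℝ) (i : Fin n) :
    fderiv ℝ (partials f) x v i = fderiv ℝ (fderiv ℝ f) x v (Pi.single i 1) := by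
  have h1 : DifferentiableAt ℝ (fderiv ℝ f) x :=
    (hf.fderiv_right (m := ∞) (by simp)).differentiable (by simp) x
  have : HasFDerivAt (partials f) (ContinuousLinearMap.pi fun i : Fin n =>
      (ContinuousLinearMap.apply ℝ ℝ (Pi.single i (1 : ℝ))).comp (fderiv ℝ (fderiv ℝ f) x)) x :=
    hasFDerivAt_pi.2 fun i => by
      change HasFDerivAt (fun y => fderiv ℝ f y (Pi.single i 1)) _ x
      exact (ContinuousLinearMap.apply ℝ ℝ (Pi.single i (1 : ℝ))).hasFDerivAt.comp x h1.hasFDerivAt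
  rw [this.fderiv]
  rfl

theorem det_fderiv_partials (hf : ContDiff ℝ ∞ f) (x : Fin n → ℝ) :
    (fderiv ℝ (partials f) x).det = (hessianMatrix f x).det := by
  rw [ContinuousLinearMap.det, ← LinearMap.det_toMatrix', ← Matrix.det_transpose]
  congr 1
  ext i j
  rw [Matrix.transpose_apply, LinearMap.toMatrix'_apply, hessianMatrix, Matrix.of_apply,
    iteratedFDeriv_two_apply]
  exact fderiv_partials_apply hf x _ _

/-- Near a nondegenerate critical point, the displacement depends smoothly and linearly on the
partial derivatives. -/
theorem exists_contDiffAt_apply_partials_eq_sub (hf : ContDiff ℝ ∞ f) {s : Fin n → ℝ}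
    (hs : fderiv ℝ f s = 0) (hdet : (hessianMatrix f s).det ≠ 0) :
    ∃ N : (Fin n → ℝ) → ((Fin n → ℝ) →L[ℝ] (Fin n → ℝ)),
      ∀ᶠ x in 𝓝 s, ContDiffAt ℝ ∞ N x ∧ N x (partials f x) = x - s := by
  obtain ⟨M, hM, hMs, hMx⟩ := exists_contDiff_eq_add_apply_sub (contDiff_partials hf) s
  rw [← det_fderiv_partials hf, ← hMs] at hdet
  let e := (M s).toContinuousLinearEquivOfDetNeZero hdet
  have he : (e : (Fin n → ℝ) →L[ℝ] (Fin n → ℝ)) = M s :=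
    ContinuousLinearMap.coe_toContinuousLinearEquivOfDetNeZero _ _
  have hnhds : ∀ᶠ x in 𝓝 s, M x ∈ Set.range
      ((↑) : ((Fin n → ℝ) ≃L[ℝ] (Fin n → ℝ)) → ((Fin n → ℝ) →L[ℝ] (Fin n → ℝ))) :=
    hM.continuous.continuousAt.eventually (he ▸ e.nhds)
  refine ⟨fun x => (M x).inverse, hnhds.mono fun x hx => ?_⟩
  obtain ⟨e', he'⟩ := hx
  refine ⟨?_, ?_⟩
  · exact ContDiffAt.comp x (he' ▸ contDiffAt_map_inverse e') hM.contDiffAt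
  · change (M x).inverse (partials f x) = x - s
    rw [hMx x, partials_eq_zero_iff.2 hs, zero_add, ← he']
    simp

/-- Integration by parts for oscillatory integrals. -/
theorem oscillatoryIntegral_sum_mul_partials (hf : ContDiff ℝ ∞ f)
    {a : (Fin n → ℝ) → (Fin n → ℂ)} (ha : ContDiff ℝ ∞ a) (hsupp : HasCompactSupport a)
    {k : ℝ} (hk : k ≠ 0) :
    oscillatoryIntegral f (fun x => ∑ j, a x j * (partials f x j : ℂ)) k =
      Complex.I / k * oscillatoryIntegral f
        (fun x => ∑ j, fderiv ℝ (fun y => a y j) x (Pi.single j 1)) k := by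
  set w : (Fin n → ℝ) → ℂ := fun x => Complex.exp (Complex.I * (k : ℂ) * (f x : ℂ)) with hw
  have hfd : ∀ x, HasFDerivAt f (fderiv ℝ f x) x :=
    fun x => (hf.differentiable (by simp) x).hasFDerivAt
  have hwd : ∀ x, HasFDerivAt w (w x • ((Complex.I * (k : ℂ)) •
      Complex.ofRealCLM.comp (fderiv ℝ f x))) x := fun x =>
    ((Complex.ofRealCLM.hasFDerivAt.comp x (hfd x)).const_mul (Complex.I * (k : ℂ))).cexp
  have hwc : ContDiff ℝ ∞ w :=
    (contDiff_const.mul (Complex.ofRealCLM.contDiff.comp hf)).cexp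
  have haj : ∀ j, ContDiff ℝ ∞ fun x => a x j := fun j => (contDiff_pi.1 ha) j
  have hsj : ∀ j, HasCompactSupport fun x => a x j := fun j =>
    hsupp.comp_left (g := fun v : Fin n → ℂ => v j) rfl
  have hpc : ∀ j, Continuous fun x => partials f x j := fun j =>
    (continuous_apply j).comp (contDiff_partials hf).continuous
  have hdc : ∀ j, Continuous fun x => fderiv ℝ (fun y => a y j) x (Pi.single j 1) := fun j =>
    ((haj j).continuous_fderiv (by simp)).clm_apply continuous_const
  have hds : ∀ j, HasCompactSupport fun x => fderiv ℝ (fun y => a y j) x (Pi.single j 1) :=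
    fun j => (hsj j).fderiv_apply (𝕜 := ℝ) _
  have hterms₁ : ∀ j, Integrable fun x => a x j * (partials f x j : ℂ) * w x := fun j =>
    (((haj j).continuous.mul (Complex.continuous_ofReal.comp (hpc j))).mul
      hwc.continuous).integrable_of_hasCompactSupport ((hsj j).mul_right.mul_right)
  have hterms₂ : ∀ j, Integrable fun x => fderiv ℝ (fun y => a y j) x (Pi.single j 1) * w x :=
    fun j => ((hdc j).mul hwc.continuous).integrable_of_hasCompactSupport (hds j).mul_right
  have hderiv (x : Fin n → ℝ) (j : Fin n) : a x j * fderiv ℝ w x (Pi.single j 1) =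
      Complex.I * k * (a x j * (partials f x j : ℂ) * w x) := by
    rw [(hwd x).fderiv]
    simp [partials]
    ring
  have key (j : Fin n) : Complex.I * k * ∫ x, a x j * (partials f x j : ℂ) * w x =
      -∫ x, fderiv ℝ (fun y => a y j) x (Pi.single j 1) * w x := by
    have := integral_mul_fderiv_eq_neg_fderiv_mul_of_integrable (μ := volume)
      (f := fun x => a x j) (g := w) (v := Pi.single j 1) (hterms₂ j)
      (by simp only [hderiv]; exact (hterms₁ j).const_mul _)
      (((haj j).continuous.mul hwc.continuous).integrable_of_hasCompactSupport (hsj j).mul_right)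
      (fun x _ => (haj j).differentiable (by simp) x)
      (fun x _ => hwc.differentiable (by simp) x)
    simp only [hderiv] at this
    rwa [integral_const_mul] at this
  have hk' : (k : ℂ) ≠ 0 := by simpa using hk
  simp only [oscillatoryIntegral, Finset.sum_mul]
  rw [integral_finsetSum _ fun j _ => hterms₁ j, integral_finsetSum _ fun j _ => hterms₂ j,
    Finset.mul_sum]
  refine Finset.sum_congr rfl fun j _ => ?_
  change ∫ x, a x j * (partials f x j : ℂ) * w x =
    Complex.I / k * ∫ x, fderiv ℝ (fun y => a y j) x (Pi.single j 1) * w x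
  rw [← neg_eq_iff_eq_neg.2 (key j)]
  field_simp
  linear_combination (∫ x, a x j * (partials f x j : ℂ) * w x) * Complex.I_sq

/-- An amplitude vanishing at the critical points of `f`, all nondegenerate, is a smooth
combination of the partial derivatives of `f`. -/
theorem exists_eq_sum_mul_partials (hf : ContDiff ℝ ∞ f) {Ω : Set (Fin n → ℝ)} (hΩ : IsOpen Ω)
    {u : (Fin n → ℝ) → ℂ} (hu : ContDiff ℝ ∞ u) (husupp : HasCompactSupport u)
    (huΩ : tsupport u ⊆ Ω)
    (hcrit : ∀ x ∈ Ω, fderiv ℝ f x = 0 → u x = 0 ∧ (hessianMatrix f x).det ≠ 0) :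
    ∃ a : (Fin n → ℝ) → (Fin n → ℂ), ContDiff ℝ ∞ a ∧ HasCompactSupport a ∧ tsupport a ⊆ Ω ∧
      ∀ x, u x = ∑ j, a x j * (partials f x j : ℂ) := by
  have hp := contDiff_partials hf
  have hconv : ∀ x, Convex ℝ {v : Fin n → ℂ | u x = ∑ j, v j * (partials f x j : ℂ)} := by
    intro x v hv w hw α β hα hβ hαβ
    simp only [Set.mem_ofPred_eq] at hv hw ⊢
    have : u x = α * u x + β * u x := by
      rw [← add_mul, ← Complex.ofReal_add, hαβ]; simp
    rw [this]
    nth_rewrite 1 [hv]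
    rw [hw, Finset.mul_sum, Finset.mul_sum, ← Finset.sum_add_distrib]
    refine Finset.sum_congr rfl fun j _ => ?_
    simp
    ring
  obtain ⟨a, ha⟩ : ∃ a : C^∞⟮𝓘(ℝ, Fin n → ℝ), Fin n → ℝ; 𝓘(ℝ, Fin n → ℂ), Fin n → ℂ⟯,
      ∀ x, a x ∈ {v : Fin n → ℂ | u x = ∑ j, v j * (partials f x j : ℂ)} := by
    refine exists_contMDiffMap_forall_mem_convex_of_local (n := ⊤) 𝓘(ℝ, Fin n → ℝ) hconv
      fun x₀ => ?_
    by_cases hx₀ : x₀ ∈ tsupport u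
    swap
    · refine ⟨(tsupport u)ᶜ, (isClosed_tsupport u).isOpen_compl.mem_nhds hx₀, fun _ => 0,
        contMDiffOn_const, fun y hy => ?_⟩
      simp [image_eq_zero_of_notMem_tsupport hy]
    by_cases hc : fderiv ℝ f x₀ = 0
    · obtain ⟨hu0, hdet⟩ := hcrit x₀ (huΩ hx₀) hc
      obtain ⟨N, hN⟩ := exists_contDiffAt_apply_partials_eq_sub hf hc hdet
      obtain ⟨U, hU, -, hUx⟩ := exists_contDiff_eq_add_apply_sub hu x₀
      refine ⟨_, hN, fun x j => U x (N x (Pi.single j 1)), ?_, ?_⟩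
      · rw [contMDiffOn_iff_contDiffOn]
        intro x hx
        refine ContDiffAt.contDiffWithinAt (contDiffAt_pi.2 fun j => ?_)
        exact hU.contDiffAt.clm_apply (hx.1.clm_apply contDiffAt_const)
      · intro x hx
        simp only [Set.mem_ofPred_eq] at hx ⊢
        have hsum : partials f x = ∑ j, partials f x j • Pi.single j (1 : ℝ) :=
          pi_eq_sum_univ' (partials f x)
        rw [hUx x, hu0, zero_add, ← hx.2]
        nth_rewrite 1 [hsum]
        simp only [map_sum, map_smul]
        refine Finset.sum_congr rfl fun j _ => ?_
        simp [mul_comm]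
    · have hne : ∀ x, partials f x ≠ 0 → (∑ i, partials f x i ^ 2) ≠ 0 := by
        intro x hx h0
        refine hx (funext fun i => ?_)
        have := (Finset.sum_eq_zero_iff_of_nonneg fun i _ => sq_nonneg (partials f x i)).1 h0 i
          (Finset.mem_univ i)
        simpa using this
      have hopen : IsOpen {x | partials f x ≠ 0} :=
        isOpen_ne_fun hp.continuous continuous_const
      refine ⟨_, hopen.mem_nhds (show partials f x₀ ≠ 0 from mt partials_eq_zero_iff.1 hc),
        fun x j => u x * ((partials f x j * (∑ i, partials f x i ^ 2)⁻¹ : ℝ) : ℂ), ?_, ?_⟩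
      · rw [contMDiffOn_iff_contDiffOn]
        intro x hx
        refine ContDiffAt.contDiffWithinAt (contDiffAt_pi.2 fun j => ?_)
        have hpj : ∀ j, ContDiffAt ℝ ∞ (fun x => partials f x j) x := fun j =>
          ((contDiff_pi.1 hp) j).contDiffAt
        exact hu.contDiffAt.mul (Complex.ofRealCLM.contDiff.contDiffAt.comp x
          ((hpj j).mul ((ContDiffAt.sum fun i _ => (hpj i).pow 2).inv (hne x hx))))
      · intro x hx
        simp only [Set.mem_ofPred_eq]
        have h1 : (∑ i, partials f x i ^ 2) * (∑ i, partials f x i ^ 2)⁻¹ = 1 :=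
          mul_inv_cancel₀ (hne x hx)
        calc u x = u x * (((∑ i, partials f x i ^ 2) * (∑ i, partials f x i ^ 2)⁻¹ : ℝ) : ℂ) := by
              rw [h1]; simp
          _ = _ := by
            push_cast
            rw [Finset.sum_mul, Finset.mul_sum]
            refine Finset.sum_congr rfl fun j _ => ?_
            ring
  obtain ⟨K, hK, huK, hKΩ⟩ := exists_compact_between husupp hΩ huΩ
  obtain ⟨ρ, hρsm, -, hρsupp, hρone⟩ :=
    exists_contMDiff_support_eq_eq_one_iff (n := ⊤) 𝓘(ℝ, Fin n → ℝ) isOpen_interior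
      (isClosed_tsupport u) huK
  have hρ : ContDiff ℝ ∞ ρ := contMDiff_iff_contDiff.1 hρsm
  have hts : tsupport (fun x => (ρ x : ℂ) • a x) ⊆ K := by
    refine closure_minimal (fun x hx => ?_) hK.isClosed
    refine interior_subset (hρsupp ▸ fun h0 : ρ x = 0 => hx ?_)
    simp [h0]
  refine ⟨fun x => (ρ x : ℂ) • a x, (Complex.ofRealCLM.contDiff.comp hρ).smul
    (contMDiff_iff_contDiff.1 a.contMDiff), hK.of_isClosed_subset (isClosed_tsupport _) hts,
    hts.trans hKΩ, fun x => ?_⟩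
  have hmul : u x = ρ x * u x := by
    by_cases hx : x ∈ tsupport u
    · rw [(hρone x).1 hx]; simp
    · simp [image_eq_zero_of_notMem_tsupport hx]
  rw [hmul]
  nth_rewrite 1 [show u x = _ from ha x]
  simp [Finset.mul_sum, mul_assoc]

end

/-- Smooth functions with compact support contained in `Ω`. -/
structure IsAmplitude {n : ℕ} (Ω : Set (Fin n → ℝ)) (u : (Fin n → ℝ) → ℂ) : Prop where
  contDiff : ContDiff ℝ ∞ u
  hasCompactSupport : HasCompactSupport u
  tsupport_subset : tsupport u ⊆ Ω

theorem rpow_isBigO_rpow_of_le {a b : ℝ} (hab : a ≤ b) :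
    (fun k : ℝ => k ^ a) =O[atTop] fun k : ℝ => k ^ b := by
  refine IsBigO.of_bound 1 ?_
  filter_upwards [eventually_ge_atTop 1] with k hk
  rw [one_mul, Real.norm_of_nonneg (by positivity), Real.norm_of_nonneg (by positivity)]
  gcongr

theorem Asymptotics.IsBigO.I_div_mul_rpow {F : ℝ → ℂ} {a : ℝ}
    (hF : F =O[atTop] fun k : ℝ => k ^ a) :
    (fun k : ℝ => Complex.I / k * F k) =O[atTop] fun k : ℝ => k ^ (a - 1) := by
  have h1 : (fun k : ℝ => Complex.I / k) =O[atTop] fun k : ℝ => k ^ (-1 : ℝ) := by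
    refine IsBigO.of_bound 1 (Eventually.of_forall fun k => ?_)
    simp [Real.rpow_neg_one]
  refine (h1.mul hF).trans_eventuallyEq ?_
  filter_upwards [eventually_gt_atTop 0] with k hk
  rw [← Real.rpow_add hk, neg_add_eq_sub]

namespace IsAmplitude

variable {n : ℕ} {Ω : Set (Fin n → ℝ)} {f : (Fin n → ℝ) → ℝ} {u : (Fin n → ℝ) → ℂ}

theorem integrable (hu : IsAmplitude Ω u) (hf : ContDiff ℝ ∞ f) (k : ℝ) :
    Integrable fun x => u x * Complex.exp (Complex.I * (k : ℂ) * (f x : ℂ)) := by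
  have := hu.contDiff.continuous
  have := hf.continuous
  exact Continuous.integrable_of_hasCompactSupport (by fun_prop) hu.hasCompactSupport.mul_right

theorem isBigO_one (hu : IsAmplitude Ω u) :
    oscillatoryIntegral f u =O[atTop] fun _ : ℝ => (1 : ℝ) := by
  refine IsBigO.of_bound (∫ x, ‖u x‖) (Eventually.of_forall fun k => ?_)
  rw [norm_one, mul_one]
  refine norm_integral_le_of_norm_le
    (hu.contDiff.continuous.integrable_of_hasCompactSupport hu.hasCompactSupport).norm
    (Eventually.of_forall fun x => ?_)
  have : Complex.I * (k : ℂ) * (f x : ℂ) = ((k * f x : ℝ) : ℂ) * Complex.I := by push_cast; ring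
  rw [norm_mul, this, Complex.norm_exp_ofReal_mul_I, mul_one]

theorem divergence {a : (Fin n → ℝ) → (Fin n → ℂ)} (ha : ContDiff ℝ ∞ a)
    (hsupp : HasCompactSupport a) (haΩ : tsupport a ⊆ Ω) :
    IsAmplitude Ω fun x => ∑ j, fderiv ℝ (fun y => a y j) x (Pi.single j 1) := by
  have hts : tsupport (fun x => ∑ j, fderiv ℝ (fun y => a y j) x (Pi.single j 1)) ⊆
      tsupport a := by
    refine closure_minimal (fun x hx => ?_) (isClosed_tsupport a)
    by_contra hxa
    refine hx (Finset.sum_eq_zero fun j _ => ?_)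
    have hev : (fun y => a y j) =ᶠ[𝓝 x] fun _ => 0 := by
      filter_upwards [notMem_tsupport_iff_eventuallyEq.1 hxa] with y hy
      simp [hy]
    rw [hev.fderiv_eq]
    simp
  refine ⟨ContDiff.sum fun j _ => ?_, hsupp.of_isClosed_subset (isClosed_tsupport _) hts,
    hts.trans haΩ⟩
  exact (((contDiff_pi.1 ha) j).fderiv_right (by simp)).clm_apply contDiff_const

end IsAmplitude

section

variable {n : ℕ} {Ω : Set (Fin n → ℝ)} {f : (Fin n → ℝ) → ℝ} {S : Finset (Fin n → ℝ)}
  {χ : (Fin n → ℝ) → (Fin n → ℝ) → ℂ}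

theorem exists_oscillatoryIntegral_eq_sum_add (hf : ContDiff ℝ ∞ f) (hΩ : IsOpen Ω)
    (hS : ∀ x ∈ Ω, fderiv ℝ f x = 0 → x ∈ S) (hdet : ∀ s ∈ S, (hessianMatrix f s).det ≠ 0)
    (hχ : ∀ s ∈ S, IsAmplitude Ω (χ s)) (hχself : ∀ s ∈ S, χ s s = 1)
    (hχne : ∀ s ∈ S, ∀ s' ∈ S, s' ≠ s → χ s s' = 0) {u : (Fin n → ℝ) → ℂ}
    (hu : IsAmplitude Ω u) :
    ∃ v, IsAmplitude Ω v ∧ ∀ k : ℝ, k ≠ 0 → oscillatoryIntegral f u k =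
      ∑ s ∈ S, u s * oscillatoryIntegral f (χ s) k +
        Complex.I / k * oscillatoryIntegral f v k := by
  set w : (Fin n → ℝ) → ℂ := fun x => u x - ∑ s ∈ S, u s * χ s x with hw
  have hwts : tsupport w ⊆ tsupport u ∪ ⋃ s ∈ S, tsupport (χ s) := by
    refine closure_minimal (fun x hx => ?_) ((isClosed_tsupport u).union
      (isClosed_biUnion_finset fun s _ => isClosed_tsupport _))
    by_contra hxn
    simp only [Set.mem_union, Set.mem_iUnion, not_or, not_exists] at hxn
    refine hx ?_
    rw [hw]
    simp only
    rw [image_eq_zero_of_notMem_tsupport hxn.1, zero_sub, neg_eq_zero]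
    exact Finset.sum_eq_zero fun s hs => by
      rw [image_eq_zero_of_notMem_tsupport (hxn.2 s hs), mul_zero]
  have hcpt : IsCompact (tsupport u ∪ ⋃ s ∈ S, tsupport (χ s)) :=
    IsCompact.union hu.hasCompactSupport
      (S.isCompact_biUnion fun s hs => (hχ s hs).hasCompactSupport)
  have hwsm : ContDiff ℝ ∞ w :=
    hu.contDiff.sub (ContDiff.sum fun s hs => contDiff_const.mul (hχ s hs).contDiff)
  obtain ⟨a, ha, hasupp, haΩ, hwa⟩ := exists_eq_sum_mul_partials hf hΩ hwsm
    (hcpt.of_isClosed_subset (isClosed_tsupport w) hwts)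
    (hwts.trans (Set.union_subset hu.tsupport_subset
      (Set.iUnion₂_subset fun s hs => (hχ s hs).tsupport_subset)))
    (fun x hx hc => by
      have hxS := hS x hx hc
      refine ⟨?_, hdet x hxS⟩
      simp only [hw]
      rw [Finset.sum_eq_single x (fun s hs hne => by rw [hχne s hs x hxS hne.symm, mul_zero])
        (fun h => absurd hxS h), hχself x hxS, mul_one, sub_self])
  refine ⟨_, IsAmplitude.divergence ha hasupp haΩ, fun k hk => ?_⟩
  rw [← oscillatoryIntegral_sum_mul_partials hf ha hasupp hk]
  simp only [← hwa]
  have hterms : ∀ s ∈ S, Integrable fun x =>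
      u s * (χ s x * Complex.exp (Complex.I * (k : ℂ) * (f x : ℂ))) :=
    fun s hs => ((hχ s hs).integrable hf k).const_mul _
  have hsplit : oscillatoryIntegral f w k = oscillatoryIntegral f u k -
      ∑ s ∈ S, u s * oscillatoryIntegral f (χ s) k := by
    simp only [oscillatoryIntegral, ← integral_const_mul]
    rw [← integral_finsetSum _ hterms, ← integral_sub (hu.integrable hf k)
      (integrable_finsetSum _ hterms)]
    refine integral_congr_ae (Eventually.of_forall fun x => ?_)
    simp only [hw, sub_mul, Finset.sum_mul, mul_assoc]
  rw [hsplit]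
  ring

/-- It suffices to know the stationary phase expansion for one amplitude localised at each
critical point. -/
theorem oscillatoryIntegral_sub_sum_isBigO (hf : ContDiff ℝ ∞ f) (hΩ : IsOpen Ω)
    (hS : ∀ x ∈ Ω, fderiv ℝ f x = 0 → x ∈ S) (hdet : ∀ s ∈ S, (hessianMatrix f s).det ≠ 0)
    (hχ : ∀ s ∈ S, IsAmplitude Ω (χ s)) (hχself : ∀ s ∈ S, χ s s = 1)
    (hχne : ∀ s ∈ S, ∀ s' ∈ S, s' ≠ s → χ s s' = 0) {c : (Fin n → ℝ) → ℝ → ℂ} {d : ℝ}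
    (hc : ∀ s ∈ S, c s =O[atTop] fun k : ℝ => k ^ (-d))
    (hχc : ∀ s ∈ S, (fun k => oscillatoryIntegral f (χ s) k - c s k) =O[atTop]
      fun k : ℝ => k ^ (-d - 1))
    {u : (Fin n → ℝ) → ℂ} (hu : IsAmplitude Ω u) :
    (fun k => oscillatoryIntegral f u k - ∑ s ∈ S, u s * c s k) =O[atTop]
      fun k : ℝ => k ^ (-d - 1) := by
  have hred := fun {u} (hu : IsAmplitude Ω u) =>
    exists_oscillatoryIntegral_eq_sum_add hf hΩ hS hdet hχ hχself hχne hu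
  have hχO : ∀ s ∈ S, oscillatoryIntegral f (χ s) =O[atTop] fun k : ℝ => k ^ (-d) := fun s hs => by
    simpa using ((hχc s hs).trans (rpow_isBigO_rpow_of_le (by linarith))).add (hc s hs)
  have hcrude : ∀ N : ℕ, ∀ {u}, IsAmplitude Ω u →
      oscillatoryIntegral f u =O[atTop] fun k : ℝ => k ^ (-min (N : ℝ) d) := by
    intro N
    induction N with
    | zero =>
      intro u hu
      refine hu.isBigO_one.trans ?_
      have := rpow_isBigO_rpow_of_le (a := 0) (b := -min ((0 : ℕ) : ℝ) d) (by simp)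
      simpa using this
    | succ N ih =>
      intro u hu
      obtain ⟨v, hv, huv⟩ := hred hu
      have hev : oscillatoryIntegral f u =ᶠ[atTop] fun k => ∑ s ∈ S, u s *
          oscillatoryIntegral f (χ s) k + Complex.I / k * oscillatoryIntegral f v k := by
        filter_upwards [eventually_ne_atTop 0] with k hk using huv k hk
      refine hev.trans_isBigO (IsBigO.add (IsBigO.fun_sum fun s hs => ?_) ?_)
      · exact ((hχO s hs).const_mul_left _).trans (rpow_isBigO_rpow_of_le (by simp))
      · refine (ih hv).I_div_mul_rpow.trans (rpow_isBigO_rpow_of_le ?_)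
        push_cast
        rcases le_total (N : ℝ) d with h | h
        · rw [min_eq_left h]
          linarith [min_le_left ((N : ℝ) + 1) d]
        · rw [min_eq_right h]
          linarith [min_le_right ((N : ℝ) + 1) d]
  obtain ⟨v, hv, huv⟩ := hred hu
  obtain ⟨N, hN⟩ := exists_nat_ge d
  have hvO := hcrude N hv
  rw [min_eq_right hN] at hvO
  have hev : (fun k => oscillatoryIntegral f u k - ∑ s ∈ S, u s * c s k) =ᶠ[atTop]
      fun k => ∑ s ∈ S, u s * (oscillatoryIntegral f (χ s) k - c s k) +
        Complex.I / k * oscillatoryIntegral f v k := by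
    filter_upwards [eventually_ne_atTop 0] with k hk
    rw [huv k hk]
    simp only [mul_sub, Finset.sum_sub_distrib]
    ring
  exact hev.trans_isBigO
    ((IsBigO.fun_sum fun s hs => (hχc s hs).const_mul_left _).add hvO.I_div_mul_rpow)

end

/-- Smooth square root near `1` in a Banach algebra, by the inverse function theorem. -/
theorem exists_contDiffAt_sqrt_near_one (𝔸 : Type*) [NormedRing 𝔸] [NormedAlgebra ℝ 𝔸]
    [CompleteSpace 𝔸] :
    ∃ σ : 𝔸 → 𝔸, σ 1 = 1 ∧ (∀ᶠ c in 𝓝 (1 : 𝔸), ContDiffAt ℝ ∞ σ c ∧ σ c * σ c = c) ∧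
      ∀ᶠ a in 𝓝 (1 : 𝔸), σ (a * a) = a := by
  let e : 𝔸 ≃L[ℝ] 𝔸 := ContinuousLinearEquiv.smulLeft (Units.mk0 (2 : ℝ) two_ne_zero)
  have hsq : ContDiffAt ℝ ω (fun a : 𝔸 => a * a) 1 := contDiffAt_id.mul contDiffAt_id
  have hd : HasFDerivAt (fun a : 𝔸 => a * a) (e : 𝔸 →L[ℝ] 𝔸) 1 := by
    refine ((hasFDerivAt_id (𝕜 := ℝ) (1 : 𝔸)).mul' (hasFDerivAt_id (1 : 𝔸))).congr_fderiv ?_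
    ext a
    simp [e, two_smul, Units.smul_def]
  have hω : (ω : WithTop ℕ∞) ≠ 0 := by simp
  set P := hsq.toOpenPartialHomeomorph _ hd hω with hP
  have hcoe : ∀ a, P a = a * a := fun a => rfl
  have h1 : (1 : 𝔸) ∈ P.source := hsq.mem_toOpenPartialHomeomorph_source hd hω
  have hP1 : P 1 = 1 := by rw [hcoe, one_mul]
  have h1t : (1 : 𝔸) ∈ P.target := hP1 ▸ P.map_source h1
  have hs1 : P.symm 1 = 1 := by simpa [hP1] using P.left_inv h1
  have hsm : ContDiffAt ℝ ω P.symm 1 := by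
    have h := hsq.to_localInverse hd hω
    simp only [one_mul] at h
    exact h
  refine ⟨P.symm, hs1, ?_, ?_⟩
  · filter_upwards [hsm.eventually (by simp), P.open_target.mem_nhds h1t] with c hc hct
    exact ⟨hc.of_le (by simp), by rw [← hcoe, P.right_inv hct]⟩
  · filter_upwards [P.open_source.mem_nhds h1] with a ha
    rw [← hcoe, P.left_inv ha]

section

attribute [local instance] Matrix.linftyOpNormedRing Matrix.linftyOpNormedAlgebra

/-- A smooth family of symmetric matrices is smoothly congruent to a nondegenerate member. -/
theorem exists_contDiffAt_transpose_mul_mul_eq {n : ℕ} {E : Type*} [NormedAddCommGroup E]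
    [NormedSpace ℝ E] {B : E → Matrix (Fin n) (Fin n) ℝ}
    (hB : ∀ i j, ContDiff ℝ ∞ fun x => B x i j) (hsymm : ∀ x, (B x).transpose = B x) {s : E}
    (hdet : (B s).det ≠ 0) :
    ∃ R : E → Matrix (Fin n) (Fin n) ℝ, R s = 1 ∧ ∀ᶠ x in 𝓝 s,
      (∀ i j, ContDiffAt ℝ ∞ (fun x => R x i j) x) ∧ (R x).transpose * B s * R x = B x := by
  obtain ⟨σ, hσ1, hσ, hσ'⟩ := exists_contDiffAt_sqrt_near_one (Matrix (Fin n) (Fin n) ℝ)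
  have hBsm : ContDiff ℝ ∞ B := by
    have : B = fun x => ∑ i, ∑ j, B x i j • Matrix.single i j (1 : ℝ) := by
      funext x
      conv_lhs => rw [Matrix.matrix_eq_sum_single (B x)]
      simp
    rw [this]
    exact ContDiff.sum fun i _ => ContDiff.sum fun j _ => (hB i j).smul contDiff_const
  have hu : IsUnit (B s).det := hdet.isUnit
  set A := B s with hA
  have hC : ContDiff ℝ ∞ fun x => A⁻¹ * B x := contDiff_const.mul hBsm
  have hCs : A⁻¹ * B s = 1 := Matrix.nonsing_inv_mul _ hu
  have hCt : Tendsto (fun x => A⁻¹ * B x) (𝓝 s) (𝓝 1) := by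
    have := hC.continuous.tendsto s
    rwa [hCs] at this
  let T : Matrix (Fin n) (Fin n) ℝ →L[ℝ] Matrix (Fin n) (Fin n) ℝ :=
    LinearMap.toContinuousLinearMap
      (Matrix.transposeLinearEquiv (Fin n) (Fin n) ℝ ℝ).toLinearMap
  have hT : ∀ M, T M = M.transpose := fun M => rfl
  have hRt : Tendsto (fun x => σ (A⁻¹ * B x)) (𝓝 s) (𝓝 1) := by
    have := (hσ.self_of_nhds.1.continuousAt.tendsto.comp hCt)
    rwa [hσ1] at this
  have hR't : Tendsto (fun x => A⁻¹ * T (σ (A⁻¹ * B x)) * A) (𝓝 s) (𝓝 1) := by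
    have := ((T.continuous.tendsto _).comp hRt).const_mul A⁻¹ |>.mul_const A
    rw [hT, Matrix.transpose_one, mul_one, Matrix.nonsing_inv_mul _ hu] at this
    exact this
  refine ⟨fun x => σ (A⁻¹ * B x), by simp only [hCs, hσ1], ?_⟩
  filter_upwards [hCt.eventually hσ, hR't.eventually hσ'] with x hx hx'
  have hAA : A * A⁻¹ = 1 := Matrix.mul_nonsing_inv _ hu
  have hAsym : A.transpose = A := hsymm s
  constructor
  · intro i j
    have hR : ContDiffAt ℝ ∞ (fun x => σ (A⁻¹ * B x)) x := hx.1.comp x hC.contDiffAt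
    let ev : Matrix (Fin n) (Fin n) ℝ →L[ℝ] ℝ :=
      LinearMap.toContinuousLinearMap (Matrix.entryLinearMap ℝ ℝ i j)
    exact ev.contDiff.contDiffAt.comp x hR
  · set R := σ (A⁻¹ * B x) with hRdef
    have hRR : R * R = A⁻¹ * B x := hx.2
    have hsq : A⁻¹ * R.transpose * A * (A⁻¹ * R.transpose * A) = A⁻¹ * B x := by
      calc _ = A⁻¹ * R.transpose * (A * A⁻¹) * R.transpose * A := by simp only [mul_assoc]
        _ = A⁻¹ * (R * R).transpose * A := by
          rw [hAA, Matrix.transpose_mul]; simp only [mul_assoc, one_mul]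
        _ = A⁻¹ * B x * (A⁻¹ * A) := by
          rw [hRR, Matrix.transpose_mul, hsymm, Matrix.transpose_nonsing_inv, hAsym]
          simp only [mul_assoc]
        _ = _ := by rw [Matrix.nonsing_inv_mul _ hu, mul_one]
    rw [hT, hsq, ← hRdef] at hx'
    calc R.transpose * A * R = (A * A⁻¹) * R.transpose * A * R := by rw [hAA, one_mul]
      _ = A * (A⁻¹ * R.transpose * A) * R := by simp only [mul_assoc]
      _ = A * (R * R) := by rw [← hx', mul_assoc]
      _ = B x := by rw [hRR, ← mul_assoc, hAA, one_mul]

end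

/-- A bilinear form on `ℝⁿ` evaluated on the diagonal, through its symmetrised matrix. -/
theorem ContinuousLinearMap.apply_apply_eq_half_dotProduct_mulVec {n : ℕ}
    (M : (Fin n → ℝ) →L[ℝ] (Fin n → ℝ) →L[ℝ] ℝ) (v : Fin n → ℝ) :
    M v v = 1 / 2 * (v ⬝ᵥ ((Matrix.of fun i j : Fin n =>
      M (Pi.single i 1) (Pi.single j 1) + M (Pi.single j 1) (Pi.single i 1)).mulVec v)) := by
  have hv : v = ∑ i, v i • (Pi.single i 1 : Fin n → ℝ) := by
    conv_lhs => rw [← Finset.univ_sum_single v]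
    refine Finset.sum_congr rfl fun i _ => ?_
    rw [← Pi.single_smul, smul_eq_mul, mul_one]
  have hexp : M v v = ∑ i, ∑ j, v i * v j * M (Pi.single i 1) (Pi.single j 1) := by
    conv_lhs => rw [hv]
    simp only [map_sum, map_smul, sum_apply, smul_apply,
      smul_eq_mul, Finset.mul_sum]
    rw [Finset.sum_comm]
    exact Finset.sum_congr rfl fun i _ => Finset.sum_congr rfl fun j _ => by ring
  have hexp' : M v v = ∑ i, ∑ j, v i * v j * M (Pi.single j 1) (Pi.single i 1) := by
    rw [hexp, Finset.sum_comm]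
    exact Finset.sum_congr rfl fun i _ => Finset.sum_congr rfl fun j _ => by ring
  have : v ⬝ᵥ ((Matrix.of fun i j : Fin n =>
      M (Pi.single i 1) (Pi.single j 1) + M (Pi.single j 1) (Pi.single i 1)).mulVec v) =
      M v v + M v v := by
    refine Eq.trans ?_ (congrArg₂ (· + ·) hexp hexp').symm
    simp only [dotProduct, Matrix.mulVec, Matrix.of_apply, Finset.mul_sum,
      ← Finset.sum_add_distrib]
    exact Finset.sum_congr rfl fun i _ => Finset.sum_congr rfl fun j _ => by ring
  rw [this]
  ring

section

variable {n : ℕ} {f : (Fin n → ℝ) → ℝ} {s : Fin n → ℝ}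

/-- Near a critical point a smooth function is a quadratic form with smooth coefficients, which
at the critical point are given by the Hessian. -/
theorem exists_contDiff_symm_quadratic (hf : ContDiff ℝ ∞ f) (hs : fderiv ℝ f s = 0) :
    ∃ B : (Fin n → ℝ) → Matrix (Fin n) (Fin n) ℝ,
      (∀ i j, ContDiff ℝ ∞ fun x => B x i j) ∧ (∀ x, (B x).transpose = B x) ∧
      B s = hessianMatrix f s ∧
      ∀ x, f x = f s + 1 / 2 * ((x - s) ⬝ᵥ ((B x).mulVec (x - s))) := by
  obtain ⟨L, hL, hLs, hLx⟩ := exists_contDiff_eq_add_apply_sub hf s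
  obtain ⟨M, hM, hMs, hMx⟩ := exists_contDiff_eq_add_apply_sub hL s
  rw [hs] at hLs
  refine ⟨fun x => Matrix.of fun i j =>
    M x (Pi.single i 1) (Pi.single j 1) + M x (Pi.single j 1) (Pi.single i 1),
    fun i j => ?_, fun x => ?_, ?_, fun x => ?_⟩
  · exact ((hM.clm_apply contDiff_const).clm_apply contDiff_const).add
      ((hM.clm_apply contDiff_const).clm_apply contDiff_const)
  · ext i j
    simp [add_comm]
  · have hLd : ∀ x, HasFDerivAt L (fderiv ℝ L x) x :=
      fun x => (hL.differentiable (by simp) x).hasFDerivAt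
    have hfd : fderiv ℝ f = fun x => (fderiv ℝ L x).flip (x - s) + L x := by
      funext x
      refine HasFDerivAt.fderiv ?_
      rw [show f = fun x => f s + L x (x - s) from funext hLx]
      refine (((hLd x).clm_apply ((hasFDerivAt_id x).sub_const s)).const_add _).congr_fderiv ?_
      ext v
      simp [add_comm]
    have hfl : DifferentiableAt ℝ (fun x => (fderiv ℝ L x).flip) s := by
      have h1 : ContDiff ℝ ∞ (fderiv ℝ L) := hL.fderiv_right (by simp)
      have h2 := LinearIsometryEquiv.contDiff (𝕜 := ℝ) (n := ∞)
        (E := (Fin n → ℝ) →L[ℝ] (Fin n → ℝ) →L[ℝ] ℝ)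
        (F := (Fin n → ℝ) →L[ℝ] (Fin n → ℝ) →L[ℝ] ℝ)
        (ContinuousLinearMap.flipₗᵢ ℝ (Fin n → ℝ) (Fin n → ℝ) ℝ)
      exact (h2.comp h1).differentiable (by simp) s
    have hdd : HasFDerivAt (fderiv ℝ f) ((M s).flip + M s) s := by
      rw [hfd, hMs]
      refine ((hfl.hasFDerivAt.clm_apply ((hasFDerivAt_id s).sub_const s)).add
        (hLd s)).congr_fderiv ?_
      ext v
      simp
    ext i j
    simp only [hessianMatrix, Matrix.of_apply]
    rw [iteratedFDeriv_two_apply, hdd.fderiv]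
    simp [add_comm]
  · rw [← ContinuousLinearMap.apply_apply_eq_half_dotProduct_mulVec, hLx x, hMx x, hLs, zero_add]

end

theorem Matrix.IsHermitian.dotProduct_mulVec_eq_sum_eigenvalues {n : ℕ}
    {H : Matrix (Fin n) (Fin n) ℝ} (hH : H.IsHermitian) (w : Fin n → ℝ) :
    w ⬝ᵥ (H.mulVec w) = ∑ i, hH.eigenvalues i *
      ((hH.eigenvectorUnitary : Matrix (Fin n) (Fin n) ℝ).transpose.mulVec w) i ^ 2 := by
  set U := (hH.eigenvectorUnitary : Matrix (Fin n) (Fin n) ℝ) with hU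
  have hsp : H = U * Matrix.diagonal hH.eigenvalues * U.transpose := by
    have := hH.spectral_theorem
    rw [Unitary.conjStarAlgAut_apply] at this
    conv_lhs => rw [this]
    simp only [Matrix.star_eq_conjTranspose,
      Matrix.conjTranspose_eq_transpose_of_trivial, ← hU]
    rfl
  conv_lhs => rw [hsp]
  rw [← Matrix.mulVec_mulVec, ← Matrix.mulVec_mulVec, Matrix.dotProduct_mulVec,
    ← Matrix.mulVec_transpose]
  simp only [dotProduct, Matrix.mulVec_diagonal]
  exact Finset.sum_congr rfl fun i _ => by ring

theorem Matrix.abs_det_eq_one_of_mem_unitaryGroup {n : ℕ} {U : Matrix (Fin n) (Fin n) ℝ}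
    (hU : U ∈ Matrix.unitaryGroup (Fin n) ℝ) : |U.det| = 1 := by
  have h := (Unitary.mem_iff.1 (Matrix.det_of_mem_unitary hU)).1
  rw [star_trivial, ← sq] at h
  exact (pow_eq_one_iff_of_nonneg (abs_nonneg _) two_ne_zero).1 (by rw [sq_abs, h])

section

variable {n : ℕ} {f : (Fin n → ℝ) → ℝ} {s : Fin n → ℝ}

theorem transpose_hessianMatrix (hf : ContDiff ℝ ∞ f) (x : Fin n → ℝ) :
    (hessianMatrix f x).transpose = hessianMatrix f x := by
  ext i j
  simp only [hessianMatrix, Matrix.transpose_apply, Matrix.of_apply, iteratedFDeriv_two_apply]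
  refine hf.contDiffAt.isSymmSndFDerivAt ?_ _ _
  rw [minSmoothness_of_isRCLikeNormedField]
  exact ENat.LEInfty.out

/-- **Morse lemma.** -/
theorem exists_morse_chart (hf : ContDiff ℝ ∞ f) (hs : fderiv ℝ f s = 0)
    (hdet : (hessianMatrix f s).det ≠ 0) :
    ∃ φ : (Fin n → ℝ) → (Fin n → ℝ), φ s = 0 ∧ |(fderiv ℝ φ s).det| = 1 ∧
      ∀ᶠ x in 𝓝 s, ContDiffAt ℝ ∞ φ x ∧ f x = f s + ∑ i,
        (Matrix.isHermitian_add_transpose_self (hessianMatrix f s)).eigenvalues i / 4 *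
          φ x i ^ 2 := by
  obtain ⟨B, hB, hBsymm, hBs, hfB⟩ := exists_contDiff_symm_quadratic hf hs
  obtain ⟨R, hRs, hR⟩ := exists_contDiffAt_transpose_mul_mul_eq hB hBsymm (hBs ▸ hdet)
  set A := hessianMatrix f s with hA
  set hH := Matrix.isHermitian_add_transpose_self A
  set U := (hH.eigenvectorUnitary : Matrix (Fin n) (Fin n) ℝ) with hU
  let T : (Fin n → ℝ) →L[ℝ] (Fin n → ℝ) := LinearMap.toContinuousLinearMap
    (Matrix.toLin' U.transpose)
  have hT : ∀ w, T w = U.transpose.mulVec w := fun w => rfl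
  have hTdet : |T.det| = 1 := by
    rw [ContinuousLinearMap.det, LinearMap.coe_toContinuousLinearMap, LinearMap.det_toLin',
      Matrix.det_transpose]
    exact Matrix.abs_det_eq_one_of_mem_unitaryGroup hH.eigenvectorUnitary.2
  have hψ : HasFDerivAt (fun x => (R x).mulVec (x - s))
      (ContinuousLinearMap.id ℝ (Fin n → ℝ)) s := by
    refine hasFDerivAt_pi'.2 fun i => ?_
    simp only [Matrix.mulVec, dotProduct]
    have hterm : ∀ j, HasFDerivAt (fun x => R x i j * (x - s) j)
        (R s i j • ContinuousLinearMap.proj j + (s - s) j • fderiv ℝ (fun x => R x i j) s) s :=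
      fun j => HasFDerivAt.mul
        ((hR.self_of_nhds.1 i j).differentiableAt (by simp)).hasFDerivAt
        ((hasFDerivAt_apply j s).sub_const (s j))
    refine (HasFDerivAt.fun_sum fun j _ => hterm j).congr_fderiv ?_
    ext v
    simp [hRs, Matrix.one_apply]
  refine ⟨fun x => T ((R x).mulVec (x - s)), by simp, ?_, ?_⟩
  · have hφ : fderiv ℝ (fun x => T ((R x).mulVec (x - s))) s = T := by
      refine HasFDerivAt.fderiv ?_
      simpa using T.hasFDerivAt.comp s hψ
    rwa [hφ]
  · filter_upwards [hR] with x hx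
    constructor
    · refine T.contDiff.contDiffAt.comp x (contDiffAt_pi.2 fun i => ?_)
      simp only [Matrix.mulVec, dotProduct]
      exact ContDiffAt.sum fun j _ => (hx.1 i j).mul
        ((contDiff_apply ℝ ℝ j).sub contDiff_const).contDiffAt
    · have hHw := fun w => hH.dotProduct_mulVec_eq_sum_eigenvalues w
      have hAsymm : A.transpose = A := transpose_hessianMatrix hf s
      set w := (R x).mulVec (x - s) with hw
      have h1 : (x - s) ⬝ᵥ ((B x).mulVec (x - s)) = w ⬝ᵥ (A.mulVec w) := by
        rw [← hx.2, hBs, ← Matrix.mulVec_mulVec, ← hw, ← Matrix.mulVec_mulVec,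
          Matrix.dotProduct_mulVec, Matrix.vecMul_transpose]
      have h2 : w ⬝ᵥ ((A + A.conjTranspose).mulVec w) = 2 * (w ⬝ᵥ (A.mulVec w)) := by
        rw [Matrix.conjTranspose_eq_transpose_of_trivial, hAsymm, Matrix.add_mulVec, dotProduct_add]
        ring
      have h3 := hHw w
      rw [h2] at h3
      rw [hfB x, h1]
      simp only [hT]
      have h4 : ∑ i, hH.eigenvalues i / 4 * (U.transpose.mulVec w) i ^ 2 =
          1 / 4 * ∑ i, hH.eigenvalues i * (U.transpose.mulVec w) i ^ 2 := by
        rw [Finset.mul_sum]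
        exact Finset.sum_congr rfl fun i _ => by ring
      rw [h4, ← h3]
      ring

end

theorem ContDiffAt.det_fderiv {n : ℕ} {φ : (Fin n → ℝ) → (Fin n → ℝ)} {x : Fin n → ℝ}
    (hφ : ContDiffAt ℝ ∞ φ x) : ContDiffAt ℝ ∞ (fun y => (fderiv ℝ φ y).det) x := by
  have hdet : ∀ y, (fderiv ℝ φ y).det = ∑ p : Equiv.Perm (Fin n),
      ((Equiv.Perm.sign p : ℤ) : ℝ) * ∏ i, fderiv ℝ φ y (Pi.single i 1) (p i) := by
    intro y
    rw [ContinuousLinearMap.det, ← LinearMap.det_toMatrix', Matrix.det_apply']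
    simp [LinearMap.toMatrix'_apply]
  simp only [hdet]
  have hd : ContDiffAt ℝ ∞ (fderiv ℝ φ) x := hφ.fderiv_right (by simp)
  refine ContDiffAt.sum fun p _ => contDiffAt_const.mul (contDiffAt_prod fun i _ => ?_)
  exact contDiffAt_pi.1 (hd.clm_apply contDiffAt_const) (p i)

/-- Transport of cut-off functions along a local diffeomorphism which is unimodular at `s`. -/
theorem exists_isAmplitude_integral_mul_comp_eq {n : ℕ} {φ : (Fin n → ℝ) → (Fin n → ℝ)}
    {s : Fin n → ℝ} (hφs : φ s = 0) (hdet : |(fderiv ℝ φ s).det| = 1)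
    (hφ : ∀ᶠ x in 𝓝 s, ContDiffAt ℝ ∞ φ x) {W : Set (Fin n → ℝ)} (hW : W ∈ 𝓝 s) :
    ∃ r : ℝ, 0 < r ∧ ∀ β : (Fin n → ℝ) → ℝ, ContDiff ℝ ∞ β →
      (∀ y, β y ≠ 0 → ∀ i, |y i| < r) →
      ∃ χ : (Fin n → ℝ) → ℂ, IsAmplitude W χ ∧ χ s = β 0 ∧
        ∀ F : (Fin n → ℝ) → ℂ, ∫ x, χ x * F (φ x) = ∫ y, (β y : ℂ) * F y := by
  have hφs' := hφ.self_of_nhds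
  have hdet0 : (fderiv ℝ φ s).det ≠ 0 := by
    intro h
    simp [h] at hdet
  have hd : HasFDerivAt φ (((fderiv ℝ φ s).toContinuousLinearEquivOfDetNeZero hdet0 :
      (Fin n → ℝ) ≃L[ℝ] (Fin n → ℝ)) : (Fin n → ℝ) →L[ℝ] (Fin n → ℝ)) s := by
    rw [ContinuousLinearMap.coe_toContinuousLinearEquivOfDetNeZero]
    exact (hφs'.differentiableAt (by simp)).hasFDerivAt
  have hne : (∞ : WithTop ℕ∞) ≠ 0 := by simp
  set P := hφs'.toOpenPartialHomeomorph φ hd hne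
  have hP : ∀ x, P x = φ x := fun x => rfl
  have hev : ∀ᶠ x in 𝓝 s, x ∈ W ∧ x ∈ P.source ∧ ContDiffAt ℝ ∞ φ x ∧
      (fderiv ℝ φ x).det ≠ 0 :=
    Eventually.and hW (Eventually.and
      (P.open_source.mem_nhds (hφs'.mem_toOpenPartialHomeomorph_source hd hne)) (hφ.and
        (hφs'.det_fderiv.continuousAt.eventually_ne hdet0)))
  obtain ⟨U, hU, hUo, hsU⟩ := eventually_nhds_iff.1 hev
  have hUs : U ⊆ P.source := fun x hx => (hU x hx).2.1
  have hVo : IsOpen (φ '' U) := P.isOpen_image_of_subset_source hUo hUs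
  have h0V : (0 : Fin n → ℝ) ∈ φ '' U := ⟨s, hsU, hφs⟩
  obtain ⟨r, hr, hrV⟩ := Metric.nhds_basis_closedBall.mem_iff.1 (hVo.mem_nhds h0V)
  refine ⟨r, hr, fun β hβ hβr => ?_⟩
  have hβV : ∀ y, β y ≠ 0 → y ∈ Metric.closedBall (0 : Fin n → ℝ) r := fun y hy => by
    rw [mem_closedBall_zero_iff]
    exact (pi_norm_le_iff_of_nonneg hr.le).2 fun i => (hβr y hy i).le
  have hVt : φ '' U ⊆ P.target := by
    rintro _ ⟨x, hx, rfl⟩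
    exact P.map_source (hUs hx)
  set K : Set (Fin n → ℝ) := P.symm '' Metric.closedBall 0 r with hK
  have hKc : IsCompact K := (isCompact_closedBall _ _).image_of_continuousOn
    (P.continuousOn_symm.mono (hrV.trans hVt))
  have hKU : K ⊆ U := by
    rintro _ ⟨y, hy, rfl⟩
    obtain ⟨x, hx, rfl⟩ := hrV hy
    rw [← hP, P.left_inv (hUs hx)]
    exact hx
  classical
  set χ : (Fin n → ℝ) → ℂ := fun x =>
    if x ∈ U then ((β (φ x) * |(fderiv ℝ φ x).det| : ℝ) : ℂ) else 0 with hχ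
  have hχU : ∀ x ∈ U, χ x = ((β (φ x) * |(fderiv ℝ φ x).det| : ℝ) : ℂ) := fun x hx => if_pos hx
  have hχU' : ∀ x ∉ U, χ x = 0 := fun x hx => if_neg hx
  have hts : tsupport χ ⊆ K := by
    refine closure_minimal (fun x hx => ?_) hKc.isClosed
    have hxU : x ∈ U := by
      by_contra h
      exact hx (hχU' x h)
    rw [Function.mem_support, hχU x hxU] at hx
    refine ⟨φ x, hβV _ fun h => hx (by simp [h]), ?_⟩
    rw [← hP, P.left_inv (hUs hxU)]
  refine ⟨χ, ⟨?_, hKc.of_isClosed_subset (isClosed_tsupport χ) hts,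
    fun x hx => (hU x (hKU (hts hx))).1⟩, ?_, fun F => ?_⟩
  · refine contDiff_iff_contDiffAt.2 fun x => ?_
    by_cases hx : x ∈ U
    · obtain ⟨-, -, hφx, hdx⟩ := hU x hx
      have hsm : ContDiffAt ℝ ∞ (fun x => β (φ x) * |(fderiv ℝ φ x).det|) x :=
        (hβ.contDiffAt.comp x hφx).mul (hφx.det_fderiv.abs hdx)
      refine (Complex.ofRealCLM.contDiff.contDiffAt.comp x hsm).congr_of_eventuallyEq ?_
      filter_upwards [hUo.mem_nhds hx] with y hy using hχU y hy
    · exact contDiffAt_const.congr_of_eventuallyEq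
        (notMem_tsupport_iff_eventuallyEq.1 fun h => hx (hKU (hts h)))
  · rw [hχU s hsU, hφs, hdet, mul_one]
  · rw [← setIntegral_eq_integral_of_forall_compl_eq_zero (s := U)
      (fun x hx => by rw [hχU' x hx, zero_mul]),
      ← setIntegral_eq_integral_of_forall_compl_eq_zero (s := φ '' U) (f := fun y => (β y : ℂ) * F y)
      (fun y hy => by
        have : β y = 0 := by
          by_contra h
          exact hy (hrV (hβV y h))
        simp [this]),
      integral_image_eq_integral_abs_det_fderiv_smul volume hUo.measurableSet
        (fun x hx => ((hU x hx).2.2.1.differentiableAt (by simp)).hasFDerivAt.hasFDerivWithinAt)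
        (P.injOn.mono hUs)]
    refine setIntegral_congr_fun hUo.measurableSet fun x hx => ?_
    simp only [hχU x hx, Complex.real_smul]
    push_cast
    ring

/-- The leading coefficient of the stationary phase expansion at the critical point `s`. -/
def stationaryCoeff {n : ℕ} (f : (Fin n → ℝ) → ℝ) (s : Fin n → ℝ) (k : ℝ) : ℂ :=
  Complex.exp (Complex.I * (k : ℂ) * (f s : ℂ)) * ∏ i, fresnelValue
    (k * ((Matrix.isHermitian_add_transpose_self (hessianMatrix f s)).eigenvalues i / 4))

section

variable {n : ℕ} {f : (Fin n → ℝ) → ℝ} {s : Fin n → ℝ}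

theorem det_add_conjTranspose_hessianMatrix (hf : ContDiff ℝ ∞ f) (s : Fin n → ℝ) :
    (hessianMatrix f s + (hessianMatrix f s).conjTranspose).det =
      2 ^ n * (hessianMatrix f s).det := by
  rw [Matrix.conjTranspose_eq_transpose_of_trivial, transpose_hessianMatrix hf, ← two_smul ℝ,
    Matrix.det_smul, Fintype.card_fin]

theorem eigenvalues_hessianMatrix_ne_zero (hf : ContDiff ℝ ∞ f)
    (hdet : (hessianMatrix f s).det ≠ 0) (i : Fin n) :
    (Matrix.isHermitian_add_transpose_self (hessianMatrix f s)).eigenvalues i ≠ 0 := by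
  have h := (Matrix.isHermitian_add_transpose_self (hessianMatrix f s)).det_eq_prod_eigenvalues
  rw [det_add_conjTranspose_hessianMatrix hf] at h
  refine Finset.prod_ne_zero_iff.1 (h ▸ ?_ : ∏ i, _ ≠ (0 : ℝ)) i (Finset.mem_univ i)
  positivity

theorem stationaryCoeff_isBigO :
    stationaryCoeff f s =O[atTop] fun k : ℝ => k ^ (-((n : ℝ) / 2)) := by
  set μ := (Matrix.isHermitian_add_transpose_self (hessianMatrix f s)).eigenvalues
  have h := (IsBigO.prod_sub_prod_rpow (Finset.univ : Finset (Fin n))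
    (F := fun i k => fresnelValue (k * (μ i / 4))) (c := fun i k => fresnelValue (k * (μ i / 4)))
    (fun i _ => by simpa using isBigO_zero _ _) (fun i _ => fresnelValue_mul_isBigO)).1
  rw [Finset.card_univ, Fintype.card_fin, neg_div] at h
  refine IsBigO.trans (IsBigO.of_bound 1 (Eventually.of_forall fun k => ?_)) h
  have : Complex.I * (k : ℂ) * (f s : ℂ) = ((k * f s : ℝ) : ℂ) * Complex.I := by push_cast; ring
  rw [stationaryCoeff, norm_mul, this, Complex.norm_exp_ofReal_mul_I]

theorem exists_isAmplitude_sub_stationaryCoeff_isBigO (hf : ContDiff ℝ ∞ f)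
    (hs : fderiv ℝ f s = 0) (hdet : (hessianMatrix f s).det ≠ 0) {W : Set (Fin n → ℝ)}
    (hW : W ∈ 𝓝 s) :
    ∃ χ : (Fin n → ℝ) → ℂ, IsAmplitude W χ ∧ χ s = 1 ∧
      (fun k => oscillatoryIntegral f χ k - stationaryCoeff f s k) =O[atTop]
        fun k : ℝ => k ^ (-(n : ℝ) / 2 - 1) := by
  obtain ⟨φ, hφs, hφdet, hφ⟩ := exists_morse_chart hf hs hdet
  set μ := (Matrix.isHermitian_add_transpose_self (hessianMatrix f s)).eigenvalues with hμ
  obtain ⟨r, hr, hχ⟩ := exists_isAmplitude_integral_mul_comp_eq hφs hφdet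
    (hφ.mono fun _ h => h.1) (inter_mem hW (hφ.mono fun _ h => h.2))
  obtain ⟨β, hβ, hβ0, hβr, hβO⟩ := exists_cutoff_integral_sub_prod_fresnelValue n hr
  obtain ⟨χ, hχa, hχs, hχint⟩ := hχ β hβ hβr
  refine ⟨χ, ⟨hχa.contDiff, hχa.hasCompactSupport, fun x hx => (hχa.tsupport_subset hx).1⟩,
    by simp [hχs, hβ0], ?_⟩
  have hO := hβO (fun i => μ i / 4)
    fun i => div_ne_zero (eigenvalues_hessianMatrix_ne_zero hf hdet i) (by norm_num)
  refine IsBigO.trans (IsBigO.of_bound 1 (Eventually.of_forall fun k => ?_)) hO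
  have hosc : oscillatoryIntegral f χ k = Complex.exp (Complex.I * (k : ℂ) * (f s : ℂ)) *
      ∫ y, (β y : ℂ) * Complex.exp (Complex.I * k * (∑ i, μ i / 4 * y i ^ 2 : ℝ)) := by
    rw [← hχint, oscillatoryIntegral, ← integral_const_mul]
    refine integral_congr_ae (Eventually.of_forall fun x => ?_)
    by_cases hx : χ x = 0
    · simp [hx]
    · have hfx : f x = f s + ∑ i, μ i / 4 * φ x i ^ 2 :=
        (hχa.tsupport_subset (subset_tsupport χ hx)).2
      simp only [hfx, Complex.ofReal_add, mul_add, Complex.exp_add]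
      ring
  have : Complex.I * (k : ℂ) * (f s : ℂ) = ((k * f s : ℝ) : ℂ) * Complex.I := by push_cast; ring
  rw [hosc, stationaryCoeff, ← mul_sub, norm_mul, this, Complex.norm_exp_ofReal_mul_I]

end

theorem Real.sign_eq_ite_sub_ite (a : ℝ) :
    Real.sign a = (if 0 < a then 1 else 0) - if a < 0 then 1 else 0 := by
  rcases lt_trichotomy a 0 with h | rfl | h
  · simp [Real.sign_of_neg h, h, h.not_gt]
  · simp
  · simp [Real.sign_of_pos h, h, h.not_gt]

theorem Real.sign_mul_of_pos {b : ℝ} (hb : 0 < b) (a : ℝ) : Real.sign (b * a) = Real.sign a := by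
  simp only [Real.sign_eq_ite_sub_ite, mul_pos_iff_of_pos_left hb, mul_neg_iff, hb, hb.not_gt, true_and, false_and, or_false]

theorem sum_sign_eigenvalues {n : ℕ} (A : Matrix (Fin n) (Fin n) ℝ) :
    ∑ i, Real.sign ((Matrix.isHermitian_add_transpose_self A).eigenvalues i) =
      (matrixSignature A : ℝ) := by
  rw [matrixSignature]
  push_cast
  rw [Finset.card_filter, Finset.card_filter]
  push_cast
  rw [← Finset.sum_sub_distrib]
  refine Finset.sum_congr rfl fun i _ => ?_
  exact Real.sign_eq_ite_sub_ite _

section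

variable {n : ℕ} {f : (Fin n → ℝ) → ℝ} {s : Fin n → ℝ}

theorem prod_fresnelValue_eigenvalues_hessianMatrix (hf : ContDiff ℝ ∞ f) {k : ℝ} (hk : 0 < k) :
    ∏ i, fresnelValue
        (k * ((Matrix.isHermitian_add_transpose_self (hessianMatrix f s)).eigenvalues i / 4)) =
      (((2 * Real.pi / k) ^ ((n : ℝ) / 2) : ℝ) : ℂ) *
        ((|(hessianMatrix f s).det| ^ (-(1 : ℝ) / 2) : ℝ) : ℂ) *
        Complex.exp (Complex.I * (Real.pi : ℂ) / 4 *
          (matrixSignature (hessianMatrix f s) : ℂ)) := by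
  set μ := (Matrix.isHermitian_add_transpose_self (hessianMatrix f s)).eigenvalues with hμ
  have hsign : ∑ i, Real.sign (k * (μ i / 4)) = (matrixSignature (hessianMatrix f s) : ℝ) := by
    rw [← sum_sign_eigenvalues]
    refine Finset.sum_congr rfl fun i _ => ?_
    rw [Real.sign_mul_of_pos hk, div_eq_inv_mul, Real.sign_mul_of_pos (by norm_num)]
  have hprod : (hessianMatrix f s).det = ∏ i, μ i / 2 := by
    have h := (Matrix.isHermitian_add_transpose_self (hessianMatrix f s)).det_eq_prod_eigenvalues
    rw [det_add_conjTranspose_hessianMatrix hf] at h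
    rw [Finset.prod_div_distrib, Finset.prod_const, Finset.card_univ, Fintype.card_fin,
      eq_div_iff (by positivity), mul_comm]
    exact h
  have hmod : ∏ i, Real.sqrt (Real.pi / |k * (μ i / 4)|) =
      (2 * Real.pi / k) ^ ((n : ℝ) / 2) * |(hessianMatrix f s).det| ^ (-(1 : ℝ) / 2) := by
    have h2 : 0 ≤ 2 * Real.pi / k := by positivity
    have hterm : ∀ i, Real.sqrt (Real.pi / |k * (μ i / 4)|) =
        (2 * Real.pi / k) ^ ((1 : ℝ) / 2) * |μ i / 2| ^ (-(1 : ℝ) / 2) := fun i => by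
      rw [neg_div, Real.rpow_neg (abs_nonneg _), ← Real.inv_rpow (abs_nonneg _),
        ← Real.mul_rpow h2 (by positivity), Real.sqrt_eq_rpow]
      congr 1
      simp only [abs_mul, abs_of_pos hk, mul_inv, div_eq_mul_inv]
      ring
    simp only [hterm]
    rw [Finset.prod_mul_distrib, Finset.prod_const, Finset.card_univ, Fintype.card_fin, hprod,
      Finset.abs_prod, Real.finsetProd_rpow _ _ fun i _ => abs_nonneg _, ← Real.rpow_mul_natCast h2]
    congr 2
    ring
  simp only [fresnelValue]
  rw [Finset.prod_mul_distrib, ← Complex.exp_sum, ← Finset.mul_sum, ← Complex.ofReal_sum, hsign,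
    ← Complex.ofReal_prod, hmod]
  push_cast
  rfl

/-- Nondegenerate critical points are isolated. -/
theorem eventually_eq_of_fderiv_eq_zero (hf : ContDiff ℝ ∞ f) (hs : fderiv ℝ f s = 0)
    (hdet : (hessianMatrix f s).det ≠ 0) : ∀ᶠ x in 𝓝 s, fderiv ℝ f x = 0 → x = s := by
  obtain ⟨N, hN⟩ := exists_contDiffAt_apply_partials_eq_sub hf hs hdet
  filter_upwards [hN] with x hx hc
  have := hx.2
  rw [partials_eq_zero_iff.2 hc, map_zero] at this
  exact (sub_eq_zero.1 this.symm)

theorem finite_inter_critical (hf : ContDiff ℝ ∞ f) {K : Set (Fin n → ℝ)} (hK : IsCompact K)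
    (hnd : ∀ x ∈ K, fderiv ℝ f x = 0 → (hessianMatrix f x).det ≠ 0) :
    {x | x ∈ K ∧ fderiv ℝ f x = 0}.Finite := by
  have hcont : Continuous (fderiv ℝ f) := hf.continuous_fderiv (by simp)
  have hC : IsCompact {x | x ∈ K ∧ fderiv ℝ f x = 0} :=
    hK.inter_right (isClosed_singleton.preimage hcont : IsClosed {x | fderiv ℝ f x = 0})
  refine hC.finite (isDiscrete_iff_forall_mem_exists_isOpen.2 fun s hs => ?_)
  obtain ⟨u, hu, huo, hsu⟩ :=
    eventually_nhds_iff.1 (eventually_eq_of_fderiv_eq_zero hf hs.2 (hnd s hs.1 hs.2))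
  refine ⟨u, huo, Set.Subset.antisymm (fun x hx => hu x hx.1 hx.2.2) ?_⟩
  exact Set.singleton_subset_iff.2 ⟨hsu, hs⟩

end

/-- **The stationary phase formula.** If all critical points of the phase `f` on the support
of the amplitude `g` are nondegenerate, then the set `S` of such critical points is finite and
`∫ g(x) e^{ikf(x)} dx = Σ_{x₀ ∈ S} e^{ikf(x₀)} (2π/k)^{n/2} |det f''(x₀)|^{-1/2}
e^{(iπ/4) sign f''(x₀)} g(x₀) + O(k^{-n/2-1})` as `k → +∞`. -/
theorem stationary_phase
    (n : ℕ) (hn : 1 ≤ n) (g : (Fin n → ℝ) → ℂ) (f : (Fin n → ℝ) → ℝ)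
    (hg : ContDiff ℝ (⊤ : ℕ∞) g) (hgsupp : HasCompactSupport g)
    (hf : ContDiff ℝ (⊤ : ℕ∞) f)
    (hnd : ∀ x₀ ∈ tsupport g, fderiv ℝ f x₀ = 0 → (hessianMatrix f x₀).det ≠ 0) :
    ∃ hS : {x₀ : Fin n → ℝ | x₀ ∈ tsupport g ∧ fderiv ℝ f x₀ = 0}.Finite,
      (fun k : ℝ =>
        (∫ x : Fin n → ℝ, g x * Complex.exp (Complex.I * (k : ℂ) * (f x : ℂ))) -
          ∑ x₀ ∈ hS.toFinset,
            Complex.exp (Complex.I * (k : ℂ) * (f x₀ : ℂ)) *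
              (((2 * Real.pi / k) ^ ((n : ℝ) / 2) : ℝ) : ℂ) *
              ((|(hessianMatrix f x₀).det| ^ (-(1 : ℝ) / 2) : ℝ) : ℂ) *
              Complex.exp (Complex.I * (Real.pi : ℂ) / 4 *
                (matrixSignature (hessianMatrix f x₀) : ℂ)) *
              g x₀)
        =O[atTop] fun k : ℝ => k ^ (-(n : ℝ) / 2 - 1) := by
  have hS := finite_inter_critical hf hgsupp hnd
  refine ⟨hS, ?_⟩
  have hmem : ∀ {s}, s ∈ hS.toFinset ↔ s ∈ tsupport g ∧ fderiv ℝ f s = 0 := by simp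
  have hdet : ∀ s ∈ hS.toFinset, (hessianMatrix f s).det ≠ 0 := fun s hs =>
    hnd s (hmem.1 hs).1 (hmem.1 hs).2
  have hiso : ∀ s ∈ hS.toFinset, ∃ W : Set (Fin n → ℝ),
      (∀ x ∈ W, fderiv ℝ f x = 0 → x = s) ∧ IsOpen W ∧ s ∈ W := fun s hs =>
    eventually_nhds_iff.1 (eventually_eq_of_fderiv_eq_zero hf (hmem.1 hs).2 (hdet s hs))
  choose! W hW hWo hsW using hiso
  have hloc := fun s (hs : s ∈ hS.toFinset) => exists_isAmplitude_sub_stationaryCoeff_isBigO hf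
    (hmem.1 hs).2 (hdet s hs) ((hWo s hs).mem_nhds (hsW s hs))
  choose! χ hχ hχself hχO using hloc
  have hcont : Continuous (fderiv ℝ f) := hf.continuous_fderiv (by simp)
  set Ω : Set (Fin n → ℝ) := {x | fderiv ℝ f x ≠ 0} ∪ ⋃ s ∈ hS.toFinset, W s with hΩdef
  have hΩ : IsOpen Ω := (isOpen_compl_singleton.preimage hcont).union
    (isOpen_biUnion hWo)
  have hΩS : ∀ x ∈ Ω, fderiv ℝ f x = 0 → x ∈ hS.toFinset := by
    rintro x (hx | hx) hc
    · exact absurd hc hx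
    · obtain ⟨s, hs, hxs⟩ := Set.mem_iUnion₂.1 hx
      rwa [hW s hs x hxs hc]
  have hWΩ : ∀ s ∈ hS.toFinset, W s ⊆ Ω := fun s hs =>
    (Set.subset_biUnion_of_mem (u := W) hs).trans Set.subset_union_right
  have hgΩ : IsAmplitude Ω g := by
    refine ⟨hg, hgsupp, fun x hx => ?_⟩
    by_cases hc : fderiv ℝ f x = 0
    · have hxS := hmem.2 ⟨hx, hc⟩
      exact hWΩ x hxS (hsW x hxS)
    · exact Or.inl hc
  have key := oscillatoryIntegral_sub_sum_isBigO (d := (n : ℝ) / 2) hf hΩ hΩS hdet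
    (fun s hs => ⟨(hχ s hs).contDiff, (hχ s hs).hasCompactSupport,
      (hχ s hs).tsupport_subset.trans (hWΩ s hs)⟩) hχself
    (fun s hs s' hs' hne => image_eq_zero_of_notMem_tsupport fun h =>
      hne (hW s hs s' ((hχ s hs).tsupport_subset h) (hmem.1 hs').2))
    (fun s _ => stationaryCoeff_isBigO) (fun s hs => by simpa only [neg_div] using hχO s hs) hgΩ
  rw [neg_div (2 : ℝ) (n : ℝ)]
  refine key.congr' ?_ EventuallyEq.rfl
  filter_upwards [eventually_gt_atTop 0] with k hk
  rw [oscillatoryIntegral]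
  congr 1
  refine Finset.sum_congr rfl fun s _ => ?_
  rw [stationaryCoeff, prod_fresnelValue_eigenvalues_hessianMatrix hf hk]
  ring
end
end

section
/- Let f, g : ℝ → ℝ be smooth functions, let a < x₀ < b, suppose f(x₀) < f(x) for every x ∈ [a,b] with x ≠ x₀, and suppose f''(x₀) > 0. Then, as ħ → 0⁺, (∫_a^b g(x) e^{-f(x)/ħ} dx) · e^{f(x₀)/ħ} · (f''(x₀)/(2πħ))^{1/2} tends to g(x₀). Equivalently, ∫_a^b g(x) e^{-f(x)/ħ} dx ∼ e^{-f(x₀)/ħ} √(2πħ/f''(x₀)) · g(x₀) as ħ → 0⁺. -/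
open Filter MeasureTheory

/-- At a critical point `x₀`, a `C²` function is `f x₀` plus a continuous multiple of
`(x - x₀) ^ 2`. -/
theorem exists_continuous_eq_add_mul_sq {f : ℝ → ℝ} (hf : ContDiff ℝ 2 f) {x₀ : ℝ}
    (h₀ : deriv f x₀ = 0) :
    ∃ φ : ℝ → ℝ, Continuous φ ∧ φ x₀ = deriv (deriv f) x₀ / 2 ∧
      ∀ x, f x = f x₀ + φ x * (x - x₀) ^ 2 := by
  refine ⟨Function.update (fun x => (f x - f x₀) / (x - x₀) ^ 2) x₀ (deriv (deriv f) x₀ / 2),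
    ?_, by simp, fun x => ?_⟩
  · rw [continuous_iff_continuousAt]
    intro x
    rcases eq_or_ne x x₀ with rfl | hx
    · rw [continuousAt_update_same]
      have ht := ((taylor_isLittleO_univ (n := 2) (x₀ := x) (by exact_mod_cast hf)).mono
        (nhdsWithin_le_nhds (s := {x}ᶜ))).tendsto_div_nhds_zero
      have ht' := ht.add_const (deriv (deriv f) x / 2)
      rw [zero_add] at ht'
      refine ht'.congr' ?_
      filter_upwards [self_mem_nhdsWithin] with y hy
      have hy' : y - x ≠ 0 := sub_ne_zero.mpr hy
      simp only [taylorWithinEval_succ, taylor_within_zero_eval, iteratedDerivWithin_univ,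
        iteratedDeriv_succ, iteratedDeriv_zero, h₀]
      norm_num
      field_simp
      ring
    · have hx' : (x - x₀) ^ 2 ≠ 0 := pow_ne_zero _ (sub_ne_zero.mpr hx)
      rw [continuousAt_update_of_ne hx]
      exact (hf.continuous.continuousAt.sub continuousAt_const).div (by fun_prop) hx'
  · rcases eq_or_ne x x₀ with rfl | hx
    · simp
    · have hx' : x - x₀ ≠ 0 := sub_ne_zero.mpr hx
      rw [Function.update_of_ne hx]
      field_simp
      ring

/-- The substitution `x = x₀ + s * y` in a Gaussian-type integral over `[a, b]`. -/
theorem inv_mul_integral_mul_exp_eq (φ g : ℝ → ℝ) {a b : ℝ} (hab : a ≤ b) (x₀ : ℝ) {s : ℝ}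
    (hs : 0 < s) :
    s⁻¹ * ∫ x in a..b, g x * Real.exp (-(φ x * (x - x₀) ^ 2) / s ^ 2) =
      ∫ y, (Set.Ioc a b).indicator g (x₀ + s * y) * Real.exp (-(φ (x₀ + s * y) * y ^ 2)) := by
  have hscale : ∀ F : ℝ → ℝ, ∫ y, F (x₀ + s * y) = s⁻¹ * ∫ x, F x := fun F => by
    rw [Measure.integral_comp_mul_left (fun y => F (x₀ + y)) s, integral_add_left_eq_self F x₀,
      abs_of_pos (inv_pos.mpr hs), smul_eq_mul]
  rw [intervalIntegral.integral_of_le hab, ← integral_indicator measurableSet_Ioc, ← hscale]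
  congr 1 with y
  rw [Set.indicator_mul_left]
  congr 2
  field_simp
  ring

/-- Concentration of a Gaussian-type integral at the point `x₀`, with a continuous positive
coefficient `φ` of the quadratic exponent. -/
theorem tendsto_inv_mul_integral_mul_exp {φ g : ℝ → ℝ} (hφ : Continuous φ) (hg : Continuous g)
    {a b x₀ : ℝ} (hax : a < x₀) (hxb : x₀ < b) (hpos : ∀ x ∈ Set.Icc a b, 0 < φ x) :
    Tendsto
      (fun s : ℝ => s⁻¹ * ∫ x in a..b, g x * Real.exp (-(φ x * (x - x₀) ^ 2) / s ^ 2))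
      (nhdsWithin 0 (Set.Ioi 0)) (nhds (g x₀ * Real.sqrt (Real.pi / φ x₀))) := by
  have hab : a ≤ b := (hax.trans hxb).le
  obtain ⟨z, hz, hzmin⟩ := isCompact_Icc.exists_isMinOn (Set.nonempty_Icc.mpr hab)
    hφ.continuousOn
  obtain ⟨C, hC⟩ := isCompact_Icc.exists_bound_of_continuousOn (s := Set.Icc a b) hg.continuousOn
  have hC₀ : 0 ≤ C := (norm_nonneg _).trans (hC z hz)
  rw [← integral_gaussian, ← integral_const_mul]
  refine Tendsto.congr' (f₁ := fun s => ∫ y, (Set.Ioc a b).indicator g (x₀ + s * y) *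
    Real.exp (-(φ (x₀ + s * y) * y ^ 2))) ?_ ?_
  · filter_upwards [self_mem_nhdsWithin] with s hs
    exact (inv_mul_integral_mul_exp_eq φ g hab x₀ hs).symm
  refine tendsto_integral_filter_of_dominated_convergence
    (fun y => C * Real.exp (-φ z * y ^ 2)) ?_ ?_ ?_ ?_
  · refine Eventually.of_forall fun s => Measurable.aestronglyMeasurable ?_
    exact ((hg.measurable.indicator measurableSet_Ioc).comp (by fun_prop)).mul
      (by fun_prop : Continuous _).measurable
  · refine Eventually.of_forall fun s => Eventually.of_forall fun y => ?_
    by_cases hy : x₀ + s * y ∈ Set.Ioc a b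
    · have hy' := Set.Ioc_subset_Icc_self hy
      rw [Set.indicator_of_mem hy, norm_mul, Real.norm_of_nonneg (Real.exp_pos _).le]
      refine mul_le_mul (hC _ hy') (Real.exp_le_exp.mpr ?_) (Real.exp_pos _).le hC₀
      have : φ z ≤ φ (x₀ + s * y) := hzmin hy'
      nlinarith [sq_nonneg y]
    · rw [Set.indicator_of_notMem hy, zero_mul, norm_zero]
      positivity
  · exact (integrable_exp_neg_mul_sq (hpos z hz)).const_mul C
  · refine Eventually.of_forall fun y => ?_
    have hlim : Tendsto (fun s : ℝ => x₀ + s * y) (nhdsWithin 0 (Set.Ioi 0)) (nhds x₀) := by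
      have hcont : Continuous fun s : ℝ => x₀ + s * y := by fun_prop
      simpa using (hcont.tendsto 0).mono_left nhdsWithin_le_nhds
    have hind : Tendsto ((Set.Ioc a b).indicator g) (nhds x₀) (nhds (g x₀)) := by
      refine hg.continuousAt.tendsto.congr' ?_
      filter_upwards [Ioc_mem_nhds hax hxb] with x hx
      rw [Set.indicator_of_mem hx]
    refine (hind.comp hlim).mul ?_
    have hexp : Continuous fun x => Real.exp (-(φ x * y ^ 2)) := by fun_prop
    simpa [Function.comp_def] using (hexp.tendsto x₀).comp hlim

/-- **Laplace's theorem.** If `f` attains a unique absolute minimum on `[a,b]` at the interior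
point `x₀`, with `f''(x₀) > 0`, then `∫_a^b g(x) e^{-f(x)/ħ} dx ∼ e^{-f(x₀)/ħ}
√(2πħ/f''(x₀)) g(x₀)` as `ħ → 0⁺`; equivalently, the integral times
`e^{f(x₀)/ħ} (f''(x₀)/(2πħ))^{1/2}` tends to `g(x₀)`. -/
theorem laplace_method
    (f g : ℝ → ℝ) (hf : ContDiff ℝ (⊤ : ℕ∞) f) (hg : ContDiff ℝ (⊤ : ℕ∞) g)
    (a b x₀ : ℝ) (hax : a < x₀) (hxb : x₀ < b)
    (hmin : ∀ x ∈ Set.Icc a b, x ≠ x₀ → f x₀ < f x)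
    (hf'' : 0 < deriv (deriv f) x₀) :
    Tendsto
      (fun hbar : ℝ =>
        (∫ x in a..b, g x * Real.exp (-f x / hbar)) * Real.exp (f x₀ / hbar) *
          Real.sqrt (deriv (deriv f) x₀ / (2 * Real.pi * hbar)))
      (nhdsWithin 0 (Set.Ioi 0)) (nhds (g x₀)) := by
  have hmem : Set.Icc a b ∈ nhds x₀ := Icc_mem_nhds hax hxb
  have hloc : IsLocalMin f x₀ := by
    filter_upwards [hmem] with x hx
    rcases eq_or_ne x x₀ with rfl | hne
    · exact le_rfl
    · exact (hmin x hx hne).le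
  obtain ⟨φ, hφ, hφ₀, hfφ⟩ := exists_continuous_eq_add_mul_sq
    (contDiff_infty.mp hf 2) hloc.deriv_eq_zero
  have hpos : ∀ x ∈ Set.Icc a b, 0 < φ x := fun x hx => by
    rcases eq_or_ne x x₀ with rfl | hne
    · rw [hφ₀]
      positivity
    · have h := hmin x hx hne
      rw [hfφ x] at h
      exact pos_of_mul_pos_left (lt_add_iff_pos_right _ |>.mp h) (sq_nonneg _)
  have hsqrt : Tendsto Real.sqrt (nhdsWithin 0 (Set.Ioi 0)) (nhdsWithin 0 (Set.Ioi 0)) := by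
    refine tendsto_nhdsWithin_iff.mpr ⟨?_, ?_⟩
    · simpa using (Real.continuous_sqrt.tendsto 0).mono_left nhdsWithin_le_nhds
    · filter_upwards [self_mem_nhdsWithin] with x hx using Real.sqrt_pos.mpr hx
  have hlim := ((tendsto_inv_mul_integral_mul_exp hφ hg.continuous hax hxb hpos).comp
    hsqrt).mul_const (Real.sqrt (deriv (deriv f) x₀ / (2 * Real.pi)))
  have hconst :
      Real.sqrt (Real.pi / φ x₀) * Real.sqrt (deriv (deriv f) x₀ / (2 * Real.pi)) = 1 := by
    rw [← Real.sqrt_mul (div_nonneg Real.pi_pos.le (hφ₀ ▸ (half_pos hf'').le)), hφ₀,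
      Real.sqrt_eq_one]
    field_simp
  rw [mul_assoc, hconst, mul_one] at hlim
  refine hlim.congr' ?_
  filter_upwards [self_mem_nhdsWithin] with h hh
  have hh' : 0 < h := hh
  have hint : (∫ x in a..b, g x * Real.exp (-f x / h)) * Real.exp (f x₀ / h) =
      ∫ x in a..b, g x * Real.exp (-(φ x * (x - x₀) ^ 2) / h) := by
    rw [← intervalIntegral.integral_mul_const]
    refine intervalIntegral.integral_congr fun x _ => ?_
    rw [mul_assoc, ← Real.exp_add, hfφ x]
    congr 2
    ring
  rw [hint, ← div_div _ _ h, Real.sqrt_div' _ hh'.le, Function.comp_apply, Real.sq_sqrt hh'.le]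
  ring
end

section
/- Let Q be a nondegenerate real symmetric n×n matrix (det Q ≠ 0) and let Q₀ be a positive definite real symmetric n×n matrix. For each ε > 0 the integral ∫_{ℝⁿ} e^{i Q(x,x) - ε Q₀(x,x)} dx converges absolutely, and lim_{ε→0⁺} ∫_{ℝⁿ} e^{i Q(x,x) - ε Q₀(x,x)} dx = π^{n/2} · e^{(iπ/4)·sign(Q)} · |det Q|^{-1/2}. In particular the limit is independent of the choice of Q₀. -/
open MeasureTheory Filter

noncomputable section

/-- The quadratic form `Q(x,x) = Σ_{i,j} Q_{ij} x_i x_j` of a real `n×n` matrix. -/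
def quadForm (n : ℕ) (Q : Matrix (Fin n) (Fin n) ℝ) (x : Fin n → ℝ) : ℝ :=
  ∑ i : Fin n, ∑ j : Fin n, Q i j * x i * x j

theorem quadForm_eq_dotProduct {n : ℕ} (Q : Matrix (Fin n) (Fin n) ℝ) (x : Fin n → ℝ) :
    quadForm n Q x = x ⬝ᵥ Q.mulVec x := by
  simp only [quadForm, dotProduct, Matrix.mulVec, Finset.mul_sum]
  refine Finset.sum_congr rfl fun i _ => Finset.sum_congr rfl fun j _ => ?_
  ring

theorem quadForm_mulVec {n : ℕ} (Q P : Matrix (Fin n) (Fin n) ℝ) (y : Fin n → ℝ) :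
    quadForm n Q (P.mulVec y) = quadForm n (P.transpose * Q * P) y := by
  rw [quadForm_eq_dotProduct, quadForm_eq_dotProduct, ← Matrix.mulVec_mulVec,
    ← Matrix.mulVec_mulVec, Matrix.dotProduct_mulVec y P.transpose, Matrix.vecMul_transpose]

theorem quadForm_diagonal {n : ℕ} (d y : Fin n → ℝ) :
    quadForm n (Matrix.diagonal d) y = ∑ i, d i * y i ^ 2 := by
  rw [quadForm_eq_dotProduct]
  simp only [dotProduct, Matrix.mulVec_diagonal]
  exact Finset.sum_congr rfl fun i _ => by ring

/-- A real symmetric matrix is diagonalized by congruence with an orthogonal matrix. -/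
theorem Matrix.IsHermitian.exists_transpose_mul_mul_eq_diagonal {n : ℕ}
    {A : Matrix (Fin n) (Fin n) ℝ} (hA : A.IsHermitian) :
    ∃ U : Matrix (Fin n) (Fin n) ℝ, U.transpose * U = 1 ∧
      U.transpose * A * U = Matrix.diagonal hA.eigenvalues := by
  refine ⟨hA.eigenvectorUnitary, ?_, ?_⟩
  · have h := Unitary.coe_star_mul_self hA.eigenvectorUnitary
    rwa [Matrix.star_eq_conjTranspose, Matrix.conjTranspose_eq_transpose_of_trivial] at h
  · have h := hA.conjStarAlgAut_star_eigenvectorUnitary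
    rw [Unitary.conjStarAlgAut_star_apply, Matrix.star_eq_conjTranspose,
      Matrix.conjTranspose_eq_transpose_of_trivial] at h
    exact h

/-- Simultaneous diagonalization by congruence of a positive definite and a symmetric matrix. -/
theorem exists_simultaneous_diagonalization {n : ℕ} {Q Q₀ : Matrix (Fin n) (Fin n) ℝ}
    (hQ : Q.IsSymm) (hQ₀ : Q₀.PosDef) :
    ∃ (P : Matrix (Fin n) (Fin n) ℝ) (d : Fin n → ℝ), P.det ≠ 0 ∧
      P.transpose * Q₀ * P = 1 ∧ P.transpose * Q * P = Matrix.diagonal d := by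
  obtain ⟨U, -, hUd⟩ := hQ₀.isHermitian.exists_transpose_mul_mul_eq_diagonal
  set D : Matrix (Fin n) (Fin n) ℝ :=
    Matrix.diagonal fun i => (√(hQ₀.isHermitian.eigenvalues i))⁻¹ with hD
  have hS : (U * D).transpose * Q₀ * (U * D) = 1 := by
    have h : (U * D).transpose * Q₀ * (U * D) = D * (U.transpose * Q₀ * U) * D := by
      simp only [Matrix.transpose_mul, hD, Matrix.diagonal_transpose, Matrix.mul_assoc]
    rw [h, hUd, hD, Matrix.diagonal_mul_diagonal, Matrix.diagonal_mul_diagonal,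
      ← Matrix.diagonal_one]
    congr 1
    funext i
    have hpos := hQ₀.eigenvalues_pos i
    have hne := (Real.sqrt_pos.2 hpos).ne'
    field_simp
    rw [Real.sq_sqrt hpos.le]
  have hB : ((U * D).transpose * Q * (U * D)).IsHermitian := by
    rw [Matrix.IsHermitian, Matrix.conjTranspose_eq_transpose_of_trivial]
    simp only [Matrix.transpose_mul, Matrix.transpose_transpose, hQ.eq, Matrix.mul_assoc]
  obtain ⟨V, hV, hVd⟩ := hB.exists_transpose_mul_mul_eq_diagonal
  have hP : (U * D * V).transpose * Q₀ * (U * D * V) = 1 := by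
    have h : (U * D * V).transpose * Q₀ * (U * D * V) =
        V.transpose * ((U * D).transpose * Q₀ * (U * D)) * V := by
      simp only [Matrix.transpose_mul, Matrix.mul_assoc]
    rw [h, hS, Matrix.mul_one, hV]
  refine ⟨U * D * V, hB.eigenvalues, fun h0 => ?_, hP, ?_⟩
  · have h := congrArg Matrix.det hP
    rw [Matrix.det_mul, h0, mul_zero, Matrix.det_one] at h
    exact zero_ne_one h
  · rw [← hVd]
    simp only [Matrix.transpose_mul, Matrix.mul_assoc]

theorem equivalent_weightedSumSquares_of_transpose_mul_mul {n : ℕ}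
    {A P : Matrix (Fin n) (Fin n) ℝ} {w : Fin n → ℝ} (hP : P.det ≠ 0)
    (h : P.transpose * A * P = Matrix.diagonal w) :
    QuadraticMap.Equivalent (QuadraticMap.weightedSumSquares ℝ w) A.toQuadraticForm' := by
  refine ⟨⟨Matrix.toLin'OfInv (M := P⁻¹) (M' := P)
    (Matrix.nonsing_inv_mul P hP.isUnit) (Matrix.mul_nonsing_inv P hP.isUnit), fun y => ?_⟩⟩
  have hy := quadForm_mulVec A P y
  rw [h, quadForm_diagonal, quadForm_eq_dotProduct] at hy
  rw [QuadraticMap.weightedSumSquares_apply]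
  trans P.mulVec y ⬝ᵥ A.mulVec (P.mulVec y)
  · exact Matrix.toLinearMap₂'_apply' A (P.mulVec y) (P.mulVec y)
  · rw [hy]
    exact Finset.sum_congr rfl fun i _ => by rw [smul_eq_mul, sq]

/-- Sylvester's law of inertia: the signature can be read off from any diagonalization by
congruence. -/
theorem matrixSignature_eq_sum_sign {n : ℕ} {Q P : Matrix (Fin n) (Fin n) ℝ} {d : Fin n → ℝ}
    (hQ : Q.IsSymm) (hP : P.det ≠ 0) (hd : P.transpose * Q * P = Matrix.diagonal d) :
    matrixSignature Q = ∑ i, (SignType.sign (d i) : ℤ) := by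
  have hA := Matrix.isHermitian_add_transpose_self Q
  obtain ⟨U, hU, hUd⟩ := hA.exists_transpose_mul_mul_eq_diagonal
  have hUdet : U.det ≠ 0 := fun h0 => by
    have h := congrArg Matrix.det hU
    rw [Matrix.det_mul, h0, mul_zero, Matrix.det_one] at h
    exact zero_ne_one h
  have hPd : P.transpose * (Q + Q.transpose) * P = Matrix.diagonal fun i => d i + d i := by
    rw [hQ.eq, Matrix.mul_add, Matrix.add_mul, hd, Matrix.diagonal_add]
  have e := (equivalent_weightedSumSquares_of_transpose_mul_mul hUdet hUd).trans
    (equivalent_weightedSumSquares_of_transpose_mul_mul hP hPd).symm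
  have hpos := e.sigPos_eq
  have hneg := e.sigNeg_eq
  rw [QuadraticForm.sigPos_weightedSumSquares, QuadraticForm.sigPos_weightedSumSquares,
    Set.ncard_eq_toFinset_card', Set.ncard_eq_toFinset_card', Set.toFinset_ofPred,
    Set.toFinset_ofPred] at hpos
  rw [QuadraticForm.sigNeg_weightedSumSquares, QuadraticForm.sigNeg_weightedSumSquares,
    Set.ncard_eq_toFinset_card', Set.ncard_eq_toFinset_card', Set.toFinset_ofPred,
    Set.toFinset_ofPred] at hneg
  rw [matrixSignature, hpos, hneg, Finset.card_filter, Finset.card_filter, Nat.cast_sum,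
    Nat.cast_sum, ← Finset.sum_sub_distrib]
  refine Finset.sum_congr rfl fun i _ => ?_
  rcases lt_trichotomy (d i) 0 with h | h | h
  · have h1 : d i + d i < 0 := by linarith
    simp [sign_neg h, h1, h1.not_gt]
  · simp [h]
  · have h1 : 0 < d i + d i := by linarith
    simp [sign_pos h, h1, h1.not_gt]

theorem measurableEmbedding_mulVec {n : ℕ} {P : Matrix (Fin n) (Fin n) ℝ} (hP : P.det ≠ 0) :
    MeasurableEmbedding P.mulVec :=
  P.toLin'.continuous_of_finiteDimensional.measurableEmbedding
    (Matrix.mulVec_injective_of_isUnit (P.isUnit_iff_isUnit_det.2 hP.isUnit))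

theorem map_mulVec_volume {n : ℕ} {P : Matrix (Fin n) (Fin n) ℝ} (hP : P.det ≠ 0) :
    Measure.map P.mulVec volume = ENNReal.ofReal |P.det⁻¹| • volume :=
  Real.map_matrix_volume_pi_eq_smul_volume_pi hP

theorem integral_comp_mulVec {n : ℕ} {P : Matrix (Fin n) (Fin n) ℝ} (hP : P.det ≠ 0)
    (f : (Fin n → ℝ) → ℂ) :
    ∫ x, f x = |P.det| * ∫ y, f (P.mulVec y) := by
  rw [← (measurableEmbedding_mulVec hP).integral_map, map_mulVec_volume hP, integral_smul_measure,
    ENNReal.toReal_ofReal (abs_nonneg _), abs_inv, Complex.real_smul, ← mul_assoc,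
    ← Complex.ofReal_mul, mul_inv_cancel₀ (abs_ne_zero.2 hP), Complex.ofReal_one, one_mul]

theorem integrable_of_integrable_comp_mulVec {n : ℕ} {P : Matrix (Fin n) (Fin n) ℝ}
    (hP : P.det ≠ 0) {f : (Fin n → ℝ) → ℂ} (hf : Integrable fun y => f (P.mulVec y)) :
    Integrable f := by
  have h := (measurableEmbedding_mulVec hP).integrable_map_iff.2 hf
  rw [map_mulVec_volume hP] at h
  refine (integrable_smul_measure ?_ ENNReal.ofReal_ne_top).1 h
  simpa using hP

theorem tendsto_sqrt_pi_div {d : ℝ} (hd : d ≠ 0) :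
    Tendsto (fun ε : ℝ => ((Real.pi : ℂ) / (ε - Complex.I * d)) ^ (1 / 2 : ℂ))
      (nhdsWithin 0 (Set.Ioi 0))
      (nhds (((√Real.pi : ℝ) : ℂ) *
        Complex.exp (Complex.I * (Real.pi : ℂ) / 4 * ((SignType.sign d : ℤ) : ℂ)) *
        ((|d| ^ (-(1 : ℝ) / 2) : ℝ) : ℂ))) := by
  have hdC : (d : ℂ) ≠ 0 := Complex.ofReal_ne_zero.2 hd
  have hval : (Real.pi : ℂ) / (((0 : ℝ) : ℂ) - Complex.I * d) =
      ((Real.pi / d : ℝ) : ℂ) * Complex.I := by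
    push_cast
    rw [zero_sub, ← neg_mul, ← Complex.inv_I]
    field_simp
  have hlim : Tendsto (fun ε : ℝ => ((Real.pi : ℂ) / (ε - Complex.I * d)) ^ (1 / 2 : ℂ))
      (nhds 0) (nhds (((Real.pi / d : ℝ) * Complex.I) ^ (1 / 2 : ℂ))) := by
    rw [← hval]
    refine ContinuousAt.tendsto (f := fun ε : ℝ =>
      ((Real.pi : ℂ) / (ε - Complex.I * d)) ^ (1 / 2 : ℂ)) ?_
    refine ContinuousAt.cpow (ContinuousAt.div (by fun_prop) (by fun_prop) ?_) (by fun_prop) ?_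
    · simpa using hd
    · rw [hval]
      refine Or.inr ?_
      rw [Complex.im_ofReal_mul, Complex.I_im, mul_one]
      exact div_ne_zero Real.pi_ne_zero hd
  convert hlim.mono_left nhdsWithin_le_nhds using 2
  have hr : 0 < Real.pi / |d| := div_pos Real.pi_pos (abs_pos.2 hd)
  have hreal : (((Real.pi / |d| : ℝ)) : ℂ) ^ (1 / 2 : ℂ) =
      ((√Real.pi : ℝ) : ℂ) * ((|d| ^ (-(1 : ℝ) / 2) : ℝ) : ℂ) := by
    rw [← Complex.ofReal_mul, neg_div, Real.rpow_neg (abs_nonneg d), Real.sqrt_eq_rpow,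
      ← div_eq_mul_inv, ← Real.div_rpow Real.pi_pos.le (abs_nonneg d),
      Complex.ofReal_cpow hr.le]
    norm_num
  have key : ∀ z : ℂ, z ≠ 0 → (((Real.pi / |d| : ℝ) : ℂ) * z) ^ (1 / 2 : ℂ) =
      ((√Real.pi : ℝ) : ℂ) * Complex.exp (Complex.log z / 2) *
        ((|d| ^ (-(1 : ℝ) / 2) : ℝ) : ℂ) := by
    intro z hz
    have hrC : ((Real.pi / |d| : ℝ) : ℂ) ≠ 0 := Complex.ofReal_ne_zero.2 hr.ne'
    rw [mul_right_comm, ← hreal, Complex.cpow_def_of_ne_zero (mul_ne_zero hrC hz),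
      Complex.cpow_def_of_ne_zero hrC, Complex.log_ofReal_mul hr hz, Complex.ofReal_log hr.le,
      ← Complex.exp_add]
    congr 1
    ring
  rcases lt_or_gt_of_ne hd with h | h
  · have h1 : ((Real.pi / d : ℝ) : ℂ) * Complex.I = ((Real.pi / |d| : ℝ) : ℂ) * -Complex.I := by
      rw [abs_of_neg h, div_neg]
      push_cast
      ring
    rw [h1, key _ (neg_ne_zero.2 Complex.I_ne_zero), Complex.log_neg_I, sign_neg h, SignType.coe_neg_one]
    congr 3
    push_cast
    ring
  · have h1 : ((Real.pi / d : ℝ) : ℂ) * Complex.I = ((Real.pi / |d| : ℝ) : ℂ) * Complex.I := by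
      rw [abs_of_pos h]
    rw [h1, key _ Complex.I_ne_zero, Complex.log_I, sign_pos h, SignType.coe_one]
    congr 3
    push_cast
    ring

theorem integrable_cexp_neg_sum_mul_sq {n : ℕ} {b : Fin n → ℂ} (hb : ∀ i, 0 < (b i).re) :
    Integrable fun y : Fin n → ℝ => Complex.exp (-∑ i, b i * (y i : ℂ) ^ 2) := by
  simp_rw [← Finset.sum_neg_distrib, Complex.exp_sum, ← neg_mul]
  exact Integrable.fintype_prod (f := fun i (x : ℝ) => Complex.exp (-b i * (x : ℂ) ^ 2))
    fun i => integrable_cexp_neg_mul_sq (hb i)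

/-- **The multi-dimensional Fresnel integral**, defined by the regularized limit `ε → 0⁺`:
for `Q` nondegenerate symmetric and `Q₀` positive definite symmetric, each regularized
integral converges absolutely and
`lim_{ε→0⁺} ∫ e^{iQ(x,x) - εQ₀(x,x)} dx = π^{n/2} e^{(iπ/4) sign Q} |det Q|^{-1/2}`;
in particular the limit does not depend on `Q₀`. -/
theorem fresnel_integral
    (n : ℕ) (Q Q₀ : Matrix (Fin n) (Fin n) ℝ)
    (hQsymm : Q.IsSymm) (hQdet : Q.det ≠ 0)
    (hQ₀symm : Q₀.IsSymm) (hQ₀pos : ∀ x : Fin n → ℝ, x ≠ 0 → 0 < quadForm n Q₀ x) :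
    (∀ ε : ℝ, 0 < ε →
      Integrable (fun x : Fin n → ℝ =>
        Complex.exp (Complex.I * (quadForm n Q x : ℂ) - (ε : ℂ) * (quadForm n Q₀ x : ℂ)))) ∧
    Tendsto
      (fun ε : ℝ => ∫ x : Fin n → ℝ,
        Complex.exp (Complex.I * (quadForm n Q x : ℂ) - (ε : ℂ) * (quadForm n Q₀ x : ℂ)))
      (nhdsWithin 0 (Set.Ioi 0))
      (nhds (((Real.pi ^ ((n : ℝ) / 2) : ℝ) : ℂ) *
        Complex.exp (Complex.I * (Real.pi : ℂ) / 4 * (matrixSignature Q : ℂ)) *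
        ((|Q.det| ^ (-(1 : ℝ) / 2) : ℝ) : ℂ))) := by
  have hQ₀ : Q₀.PosDef := by
    refine Matrix.PosDef.of_dotProduct_mulVec_pos ?_ fun x hx => ?_
    · rw [Matrix.IsHermitian, Matrix.conjTranspose_eq_transpose_of_trivial, hQ₀symm.eq]
    · rw [star_trivial, ← quadForm_eq_dotProduct]
      exact hQ₀pos x hx
  obtain ⟨P, d, hP, hP₀, hPd⟩ := exists_simultaneous_diagonalization hQsymm hQ₀
  have hdet : |P.det| ^ 2 * |Q.det| = ∏ i, |d i| := by
    have h := congrArg Matrix.det hPd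
    rw [Matrix.det_mul, Matrix.det_mul, Matrix.det_transpose, Matrix.det_diagonal] at h
    rw [← Finset.abs_prod, ← h, abs_mul, abs_mul]
    ring
  have hd : ∀ i, d i ≠ 0 := fun i hi => by
    have h0 : ∏ i, |d i| = 0 := Finset.prod_eq_zero (Finset.mem_univ i) (by rw [hi, abs_zero])
    rw [← hdet] at h0
    exact mul_ne_zero (pow_ne_zero 2 (abs_ne_zero.2 hP)) (abs_ne_zero.2 hQdet) h0
  have hexp : ∀ (ε : ℝ) (y : Fin n → ℝ),
      Complex.I * (quadForm n Q (P.mulVec y) : ℂ) - (ε : ℂ) * (quadForm n Q₀ (P.mulVec y) : ℂ) =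
        -∑ i, ((ε : ℂ) - Complex.I * d i) * (y i : ℂ) ^ 2 := fun ε y => by
    rw [quadForm_mulVec, quadForm_mulVec, hP₀, hPd, ← Matrix.diagonal_one, quadForm_diagonal,
      quadForm_diagonal]
    push_cast
    rw [Finset.mul_sum, Finset.mul_sum, ← Finset.sum_sub_distrib, ← Finset.sum_neg_distrib]
    exact Finset.sum_congr rfl fun i _ => by ring
  have hre : ∀ ε : ℝ, 0 < ε → ∀ i, 0 < ((ε : ℂ) - Complex.I * d i).re := fun ε hε i => by
    simpa using hε
  refine ⟨fun ε hε => integrable_of_integrable_comp_mulVec hP ?_, ?_⟩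
  · simp_rw [hexp]
    exact integrable_cexp_neg_sum_mul_sq (hre ε hε)
  have hint : ∀ ε ∈ Set.Ioi (0 : ℝ), ((|P.det| : ℝ) : ℂ) *
      ∏ i, ((Real.pi : ℂ) / (ε - Complex.I * d i)) ^ (1 / 2 : ℂ) = ∫ x : Fin n → ℝ,
        Complex.exp (Complex.I * (quadForm n Q x : ℂ) - (ε : ℂ) * (quadForm n Q₀ x : ℂ)) := by
    intro ε hε
    have h := GaussianFourier.integral_cexp_neg_sum_mul_add (hre ε hε) 0
    simp only [Pi.zero_apply, zero_mul, Finset.sum_const_zero, add_zero, ne_eq, OfNat.ofNat_ne_zero,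
      not_false_eq_true, zero_pow, zero_div, Complex.exp_zero, mul_one] at h
    rw [integral_comp_mulVec hP, ← h]
    simp_rw [hexp]
  refine Tendsto.congr' (eventually_nhdsWithin_of_forall hint) ?_
  convert (tendsto_finsetProd Finset.univ fun i _ =>
    tendsto_sqrt_pi_div (hd i)).const_mul ((|P.det| : ℝ) : ℂ) using 2
  have hpi : ∏ _i : Fin n, ((√Real.pi : ℝ) : ℂ) = ((Real.pi ^ ((n : ℝ) / 2) : ℝ) : ℂ) := by
    rw [Finset.prod_const, Finset.card_univ, Fintype.card_fin, ← Complex.ofReal_pow,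
      Real.sqrt_eq_rpow, ← Real.rpow_natCast, ← Real.rpow_mul Real.pi_pos.le]
    congr 2
    ring
  have habs : |Q.det| ^ (-(1 : ℝ) / 2) = |P.det| * ∏ i, |d i| ^ (-(1 : ℝ) / 2) := by
    rw [Real.finsetProd_rpow _ _ fun i _ => abs_nonneg _, ← hdet,
      Real.mul_rpow (by positivity) (abs_nonneg _), ← mul_assoc, ← Real.rpow_natCast,
      ← Real.rpow_mul (abs_nonneg _)]
    norm_num
    rw [Real.rpow_neg_one, mul_inv_cancel₀ (abs_ne_zero.2 hP), one_mul]
  rw [Finset.prod_mul_distrib, Finset.prod_mul_distrib, hpi, ← Complex.exp_sum, ← Finset.mul_sum,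
    matrixSignature_eq_sum_sign hQsymm hP hPd, habs]
  push_cast
  ring
end
end

section
/- (Wick's lemma.) Let Q be a positive definite real symmetric n×n matrix, and for a polynomial p on ℝⁿ define the normalized Gaussian expectation ⟪p⟫ = (∫_{ℝⁿ} p(x) e^{-½Q(x,x)} dx) / (∫_{ℝⁿ} e^{-½Q(x,x)} dx). Then for any d ≥ 1 and any indices i₁,…,i_d ∈ {1,…,n}: (a) if d is odd, ⟪x_{i₁}⋯x_{i_d}⟫ = 0; (b) if d = 2m is even, ⟪x_{i₁}⋯x_{i_{2m}}⟫ = (1/(2^m m!)) Σ_{σ ∈ S_{2m}} ∏_{j=1}^{m} (Q⁻¹)_{i_{σ(2j-1)}, i_{σ(2j)}}, the sum ranging over all permutations σ of {1,…,2m}. In particular ⟪x_i x_j⟫ = (Q⁻¹)_{ij}. -/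
open MeasureTheory

noncomputable section

/-- The normalized Gaussian expectation value
`⟪p⟫ = (∫ p(x) e^{-½Q(x,x)} dx) / (∫ e^{-½Q(x,x)} dx)`. -/
def gaussExp (n : ℕ) (Q : Matrix (Fin n) (Fin n) ℝ) (p : (Fin n → ℝ) → ℝ) : ℝ :=
  (∫ x : Fin n → ℝ, p x * Real.exp (-(1 / 2) * quadForm n Q x)) /
    ∫ x : Fin n → ℝ, Real.exp (-(1 / 2) * quadForm n Q x)

section Combinatorics

/-- The permutation of `Fin (d + 1)` fixing `0` and acting as `π` on the successors. -/
def permSucc {d : ℕ} (π : Equiv.Perm (Fin d)) : Equiv.Perm (Fin (d + 1)) :=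
  Equiv.Perm.decomposeFin.symm (0, π)

lemma permSucc_zero {d : ℕ} (π : Equiv.Perm (Fin d)) : permSucc π 0 = 0 := by
  simp [permSucc]

lemma permSucc_succ {d : ℕ} (π : Equiv.Perm (Fin d)) (j : Fin d) :
    permSucc π j.succ = (π j).succ := by
  simp [permSucc]

lemma two_mul_val_lt {m : ℕ} (j : Fin m) : 2 * (j : ℕ) < 2 * m := by
  have := j.isLt
  omega

lemma two_mul_val_add_one_lt {m : ℕ} (j : Fin m) : 2 * (j : ℕ) + 1 < 2 * m := by
  have := j.isLt
  omega

/-- The sum over all permutations of the product of the values of `C` over consecutive pairs. -/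
def pairingSum {α : Type*} (C : α → α → ℝ) (m : ℕ) (idx : Fin (2 * m) → α) : ℝ :=
  ∑ σ : Equiv.Perm (Fin (2 * m)), ∏ j : Fin m,
    C (idx (σ ⟨2 * (j : ℕ), two_mul_val_lt j⟩))
      (idx (σ ⟨2 * (j : ℕ) + 1, two_mul_val_add_one_lt j⟩))

lemma pairingSum_succ {α : Type*} (C : α → α → ℝ) (m : ℕ) (idx : Fin (2 * m + 2) → α) :
    pairingSum C (m + 1) idx = ∑ σ : Equiv.Perm (Fin (2 * m + 2)),
      C (idx (σ 0)) (idx (σ 1)) * ∏ j : Fin m,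
        C (idx (σ (Fin.succ (Fin.succ ⟨2 * (j : ℕ), two_mul_val_lt j⟩))))
          (idx (σ (Fin.succ (Fin.succ ⟨2 * (j : ℕ) + 1, two_mul_val_add_one_lt j⟩)))) := by
  unfold pairingSum
  refine Finset.sum_congr rfl fun σ _ => ?_
  rw [Fin.prod_univ_succ]
  rfl

/-- Summing the pairing sums of the last `2 * m` indices over all permutations recovers
`(2 * m)!` copies of the full pairing sum. -/
lemma sum_perm_mul_pairingSum {α : Type*} (C : α → α → ℝ) (m : ℕ) (idx : Fin (2 * m + 2) → α) :
    ∑ σ : Equiv.Perm (Fin (2 * m + 2)), C (idx (σ 0)) (idx (σ 1)) *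
        pairingSum C m (fun j => idx (σ j.succ.succ)) =
      (Nat.factorial (2 * m) : ℝ) * pairingSum C (m + 1) idx := by
  simp_rw [pairingSum_succ, pairingSum, Finset.mul_sum]
  rw [Finset.sum_comm]
  have key : ∀ τ : Equiv.Perm (Fin (2 * m)),
      ∑ σ : Equiv.Perm (Fin (2 * m + 2)), C (idx (σ 0)) (idx (σ 1)) * ∏ j : Fin m,
        C (idx (σ (τ ⟨2 * (j : ℕ), two_mul_val_lt j⟩).succ.succ))
          (idx (σ (τ ⟨2 * (j : ℕ) + 1, two_mul_val_add_one_lt j⟩).succ.succ)) =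
      ∑ σ : Equiv.Perm (Fin (2 * m + 2)), C (idx (σ 0)) (idx (σ 1)) * ∏ j : Fin m,
        C (idx (σ (Fin.succ (Fin.succ ⟨2 * (j : ℕ), two_mul_val_lt j⟩))))
          (idx (σ (Fin.succ (Fin.succ ⟨2 * (j : ℕ) + 1, two_mul_val_add_one_lt j⟩)))) := by
    intro τ
    refine Fintype.sum_equiv (Equiv.mulRight (permSucc (permSucc τ))) _ _ fun σ => ?_
    simp only [Equiv.coe_mulRight, Equiv.Perm.mul_apply, permSucc_succ, permSucc_zero,
      ← Fin.succ_zero_eq_one]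
  rw [Finset.sum_congr rfl fun τ _ => key τ, Finset.sum_const, Finset.card_univ,
    Fintype.card_perm, Fintype.card_fin, nsmul_eq_mul, Finset.mul_sum]

/-- A symmetric family of moments satisfying the recursion obtained by pairing the first index
with each of the others is given by normalized pairing sums. -/
theorem eq_pairingSum_of_recursion {α : Type*} (C : α → α → ℝ)
    (M : (d : ℕ) → (Fin d → α) → ℝ) (hzero : ∀ idx, M 0 idx = 1)
    (hperm : ∀ d idx (σ : Equiv.Perm (Fin d)), M d (fun j => idx (σ j)) = M d idx)
    (hrec : ∀ d (idx : Fin (d + 2) → α), M (d + 2) idx =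
      ∑ k : Fin (d + 1), C (idx 0) (idx k.succ) * M d (fun j => idx (k.succAbove j).succ))
    (m : ℕ) (idx : Fin (2 * m) → α) :
    M (2 * m) idx = 1 / (2 ^ m * (Nat.factorial m) : ℝ) * pairingSum C m idx := by
  induction m with
  | zero =>
    have h : M (2 * 0) idx = 1 := hzero idx
    simp [h, pairingSum]
  | succ m ih =>
    change Fin (2 * m + 2) → α at idx
    change M (2 * m + 2) idx = _
    have hk : ∀ k : Fin (2 * m + 1),
        ∑ σ : Equiv.Perm (Fin (2 * m + 2)), C (idx (σ 0)) (idx (σ k.succ)) *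
          M (2 * m) (fun j => idx (σ (k.succAbove j).succ)) =
        ∑ σ : Equiv.Perm (Fin (2 * m + 2)), C (idx (σ 0)) (idx (σ 1)) *
          M (2 * m) (fun j => idx (σ j.succ.succ)) := by
      intro k
      refine Fintype.sum_equiv (Equiv.mulRight (permSucc k.cycleRange.symm)) _ _ fun σ => ?_
      simp only [Equiv.coe_mulRight, Equiv.Perm.mul_apply, permSucc_succ, permSucc_zero,
        Fin.cycleRange_symm_succ, Fin.cycleRange_symm_zero, ← Fin.succ_zero_eq_one]
    have hsum : (Nat.factorial (2 * m + 2) : ℝ) * M (2 * m + 2) idx =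
        (2 * m + 1) * (1 / (2 ^ m * (Nat.factorial m) : ℝ) *
          ((Nat.factorial (2 * m) : ℝ) * pairingSum C (m + 1) idx)) := by
      calc (Nat.factorial (2 * m + 2) : ℝ) * M (2 * m + 2) idx
          = ∑ σ : Equiv.Perm (Fin (2 * m + 2)), M (2 * m + 2) (fun j => idx (σ j)) := by
            simp [hperm, Fintype.card_perm]
        _ = ∑ k : Fin (2 * m + 1), ∑ σ : Equiv.Perm (Fin (2 * m + 2)),
              C (idx (σ 0)) (idx (σ k.succ)) *
                M (2 * m) (fun j => idx (σ (k.succAbove j).succ)) := by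
            rw [Finset.sum_comm]
            exact Finset.sum_congr rfl fun σ _ => hrec _ _
        _ = (2 * m + 1) * ∑ σ : Equiv.Perm (Fin (2 * m + 2)), C (idx (σ 0)) (idx (σ 1)) *
              M (2 * m) (fun j => idx (σ j.succ.succ)) := by
            rw [Finset.sum_congr rfl fun k _ => hk k]
            simp
        _ = _ := by
            rw [← sum_perm_mul_pairingSum, Finset.mul_sum (a := 1 / _)]
            congr 1
            refine Finset.sum_congr rfl fun σ _ => ?_
            rw [ih]
            ring
    have h2 : (Nat.factorial (2 * m) : ℝ) ≠ 0 := by positivity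
    have h1 : (Nat.factorial m : ℝ) ≠ 0 := by positivity
    rw [Nat.factorial_succ, Nat.factorial_succ] at hsum
    rw [Nat.factorial_succ]
    push_cast at hsum ⊢
    field_simp at hsum ⊢
    linear_combination hsum

end Combinatorics

section Integrability

variable {n : ℕ} {Q : Matrix (Fin n) (Fin n) ℝ}

lemma continuous_quadForm (n : ℕ) (Q : Matrix (Fin n) (Fin n) ℝ) :
    Continuous (quadForm n Q) := by
  unfold quadForm
  fun_prop

lemma quadForm_smul (Q : Matrix (Fin n) (Fin n) ℝ) (c : ℝ) (x : Fin n → ℝ) :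
    quadForm n Q (c • x) = c ^ 2 * quadForm n Q x := by
  simp only [quadForm, Finset.mul_sum, Pi.smul_apply, smul_eq_mul]
  exact Finset.sum_congr rfl fun i _ => Finset.sum_congr rfl fun j _ => by ring

/-- A positive definite quadratic form dominates a multiple of the sum of squares. -/
lemma exists_mul_sum_sq_le_quadForm (hQ : ∀ x : Fin n → ℝ, x ≠ 0 → 0 < quadForm n Q x) :
    ∃ b : ℝ, 0 < b ∧ ∀ x : Fin n → ℝ, b * ∑ i, x i ^ 2 ≤ quadForm n Q x := by
  obtain ⟨c, hc, hcQ⟩ := (isCompact_sphere (0 : Fin n → ℝ) 1).exists_forall_le'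
    (continuous_quadForm n Q).continuousOn (a := 0)
    fun x hx => hQ x (by rintro rfl; simp at hx)
  refine ⟨c / (n + 1), by positivity, fun x => ?_⟩
  rcases eq_or_ne x 0 with rfl | hx
  · simp [quadForm]
  have hx' : 0 < ‖x‖ := norm_pos_iff.2 hx
  have hsphere : c ≤ quadForm n Q (‖x‖⁻¹ • x) := hcQ _ (by simp [norm_smul, hx'.ne'])
  rw [quadForm_smul, inv_pow, inv_mul_eq_div, le_div_iff₀ (by positivity)] at hsphere
  have hsq : ∑ i, x i ^ 2 ≤ (n + 1) * ‖x‖ ^ 2 := by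
    calc ∑ i, x i ^ 2 ≤ ∑ _i : Fin n, ‖x‖ ^ 2 := by
          refine Finset.sum_le_sum fun i _ => ?_
          rw [← sq_abs]
          exact pow_le_pow_left₀ (abs_nonneg _) (norm_le_pi_norm x i) 2
      _ ≤ (n + 1) * ‖x‖ ^ 2 := by
          simp only [Finset.sum_const, Finset.card_univ, Fintype.card_fin, nsmul_eq_mul]
          nlinarith [sq_nonneg ‖x‖]
  calc c / (n + 1) * ∑ i, x i ^ 2 ≤ c / (n + 1) * ((n + 1) * ‖x‖ ^ 2) := by gcongr
    _ = c * ‖x‖ ^ 2 := by field_simp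
    _ ≤ _ := hsphere

/-- Monomials are integrable against a positive definite Gaussian. -/
lemma integrable_prod_mul_exp_quadForm (hQ : ∀ x : Fin n → ℝ, x ≠ 0 → 0 < quadForm n Q x)
    {d : ℕ} (idx : Fin d → Fin n) :
    Integrable fun x : Fin n → ℝ =>
      (∏ j, x (idx j)) * Real.exp (-(1 / 2) * quadForm n Q x) := by
  obtain ⟨b, hb, hbQ⟩ := exists_mul_sum_sq_le_quadForm hQ
  have hdom : Integrable fun x : Fin n → ℝ =>
      ∏ i, (x i ^ (Finset.univ.filter fun j => idx j = i).card *
        Real.exp (-(b / 2) * x i ^ 2)) := by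
    refine Integrable.fintype_prod (f := fun i (t : ℝ) =>
      t ^ (Finset.univ.filter fun j => idx j = i).card * Real.exp (-(b / 2) * t ^ 2)) fun i => ?_
    simpa using integrable_rpow_mul_exp_neg_mul_sq (b := b / 2) (by positivity)
      (s := ((Finset.univ.filter fun j => idx j = i).card : ℝ))
      (by linarith [Nat.cast_nonneg (α := ℝ) (Finset.univ.filter fun j => idx j = i).card])
  refine hdom.mono ?_ (Filter.Eventually.of_forall fun x => ?_)
  · have := continuous_quadForm n Q
    exact Continuous.aestronglyMeasurable (by fun_prop)
  · have hprod : ∏ j, x (idx j) =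
        ∏ i, x i ^ (Finset.univ.filter fun j => idx j = i).card := by
      simp_rw [← Finset.prod_const]
      exact (Finset.prod_fiberwise' Finset.univ idx x).symm
    rw [Finset.prod_mul_distrib, ← hprod, ← Real.exp_sum, ← Finset.mul_sum, norm_mul, norm_mul,
      Real.norm_eq_abs (Real.exp _), Real.norm_eq_abs (Real.exp _), Real.abs_exp, Real.abs_exp]
    refine mul_le_mul_of_nonneg_left (Real.exp_le_exp.2 ?_) (norm_nonneg _)
    linarith [hbQ x]

lemma integrable_exp_quadForm (hQ : ∀ x : Fin n → ℝ, x ≠ 0 → 0 < quadForm n Q x) :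
    Integrable fun x : Fin n → ℝ => Real.exp (-(1 / 2) * quadForm n Q x) := by
  simpa using integrable_prod_mul_exp_quadForm hQ (Fin.elim0 : Fin 0 → Fin n)

end Integrability

section IntegrationByParts

variable {n : ℕ} {Q : Matrix (Fin n) (Fin n) ℝ}

lemma isUnit_det_of_quadForm_pos (hQ : ∀ x : Fin n → ℝ, x ≠ 0 → 0 < quadForm n Q x) :
    IsUnit Q.det := by
  rw [isUnit_iff_ne_zero]
  intro hdet
  obtain ⟨v, hv, hQv⟩ := Matrix.exists_mulVec_eq_zero_iff.2 hdet
  refine (hQ v hv).ne' ?_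
  have h : quadForm n Q v = v ⬝ᵥ Q.mulVec v := by
    simp only [quadForm, dotProduct, Matrix.mulVec, Finset.mul_sum]
    exact Finset.sum_congr rfl fun i _ => Finset.sum_congr rfl fun j _ => by ring
  rw [h, hQv, dotProduct_zero]

lemma quadForm_add_smul (hQsymm : Q.IsSymm) (x v : Fin n → ℝ) (t : ℝ) :
    quadForm n Q (x + t • v) =
      quadForm n Q x + t * (2 * (Q.vecMul v ⬝ᵥ x)) + t ^ 2 * quadForm n Q v := by
  have hcross : ∑ i, ∑ j, Q i j * x i * v j = ∑ i, ∑ j, Q i j * v i * x j := by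
    rw [Finset.sum_comm]
    refine Finset.sum_congr rfl fun i _ => Finset.sum_congr rfl fun j _ => ?_
    rw [hQsymm.apply]
    ring
  have hdot : Q.vecMul v ⬝ᵥ x = ∑ i, ∑ j, Q i j * v i * x j := by
    simp only [dotProduct, Matrix.vecMul, Finset.sum_mul]
    rw [Finset.sum_comm]
    exact Finset.sum_congr rfl fun i _ => Finset.sum_congr rfl fun j _ => by ring
  calc quadForm n Q (x + t • v)
      = quadForm n Q x + t * (∑ i, ∑ j, Q i j * x i * v j + ∑ i, ∑ j, Q i j * v i * x j)
          + t ^ 2 * quadForm n Q v := by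
        simp only [quadForm, Finset.mul_sum, ← Finset.sum_add_distrib, Pi.add_apply,
          Pi.smul_apply, smul_eq_mul]
        exact Finset.sum_congr rfl fun i _ => Finset.sum_congr rfl fun j _ => by ring
    _ = _ := by
        rw [hcross, hdot]
        ring

lemma hasLineDerivAt_exp_quadForm (hQsymm : Q.IsSymm) (x v : Fin n → ℝ) :
    HasLineDerivAt ℝ (fun x => Real.exp (-(1 / 2) * quadForm n Q x))
      (-(Q.vecMul v ⬝ᵥ x) * Real.exp (-(1 / 2) * quadForm n Q x)) x v := by
  unfold HasLineDerivAt
  simp only [quadForm_add_smul hQsymm]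
  have h := (((((hasDerivAt_id (0 : ℝ)).mul_const (2 * (Q.vecMul v ⬝ᵥ x))).const_add
    (quadForm n Q x)).add (((hasDerivAt_id (0 : ℝ)).pow 2).mul_const
      (quadForm n Q v))).const_mul (-(1 / 2) : ℝ)).exp
  convert! h using 1
  simp
  ring

lemma hasLineDerivAt_prod_eval {d : ℕ} (idx : Fin (d + 1) → Fin n) (x v : Fin n → ℝ) :
    HasLineDerivAt ℝ (fun x : Fin n → ℝ => ∏ j, x (idx j))
      (∑ k, v (idx k) * ∏ j, x (idx (k.succAbove j))) x v := by
  unfold HasLineDerivAt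
  have h := HasDerivAt.fun_finsetProd (u := Finset.univ) (x := (0 : ℝ))
    (f := fun j t => (x + t • v) (idx j)) (f' := fun j => v (idx j)) fun j _ => by
      simpa using ((hasDerivAt_id (0 : ℝ)).mul_const (v (idx j))).const_add (x (idx j))
  convert! h using 1
  refine Finset.sum_congr rfl fun k _ => ?_
  rw [smul_eq_mul, mul_comm]
  congr 1
  rw [← Finset.compl_singleton, ← Fin.image_succAbove_univ,
    Finset.prod_image k.succAbove_right_injective.injOn]
  simp

/-- Gaussian integration by parts for monomials. -/
lemma integral_prod_mul_exp_quadForm (hQsymm : Q.IsSymm)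
    (hQ : ∀ x : Fin n → ℝ, x ≠ 0 → 0 < quadForm n Q x)
    {d : ℕ} (idx : Fin (d + 2) → Fin n) :
    ∫ x : Fin n → ℝ, (∏ j, x (idx j)) * Real.exp (-(1 / 2) * quadForm n Q x) =
      ∑ k : Fin (d + 1), Q⁻¹ (idx 0) (idx k.succ) * ∫ x : Fin n → ℝ,
        (∏ j, x (idx (k.succAbove j).succ)) * Real.exp (-(1 / 2) * quadForm n Q x) := by
  have hdir : ∀ x, Q.vecMul (Q⁻¹ (idx 0)) ⬝ᵥ x = x (idx 0) := by
    intro x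
    have h : Q.vecMul (Q⁻¹ (idx 0)) = Pi.single (idx 0) 1 := by
      ext j
      have := congrFun (congrFun (Q.nonsing_inv_mul (isUnit_det_of_quadForm_pos hQ)) (idx 0)) j
      simpa [Matrix.mul_apply, Matrix.vecMul, dotProduct, Matrix.one_apply, Pi.single_apply,
        eq_comm] using this
    rw [h, single_dotProduct, one_mul]
  have hint := fun k : Fin (d + 1) =>
    (integrable_prod_mul_exp_quadForm hQ fun j => idx (k.succAbove j).succ).const_mul
      (Q⁻¹ (idx 0) (idx k.succ))
  have hibp := integral_bilinear_hasLineDerivAt_right_eq_neg_left_of_integrable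
    (μ := (volume : Measure (Fin n → ℝ))) (B := ContinuousLinearMap.mul ℝ ℝ)
    (f := fun x => ∏ j : Fin (d + 1), x (idx j.succ))
    (f' := fun x => ∑ k : Fin (d + 1), Q⁻¹ (idx 0) (idx k.succ) *
      ∏ j, x (idx (k.succAbove j).succ))
    (g := fun x => Real.exp (-(1 / 2) * quadForm n Q x))
    (g' := fun x => -x (idx 0) * Real.exp (-(1 / 2) * quadForm n Q x))
    (v := Q⁻¹ (idx 0))
    (by
      simp only [ContinuousLinearMap.mul_apply', Finset.sum_mul, mul_assoc]
      exact integrable_finsetSum _ fun k _ => hint k)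
    (by
      refine (integrable_prod_mul_exp_quadForm hQ idx).neg.congr (.of_forall fun x => ?_)
      simp only [Pi.neg_apply, ContinuousLinearMap.mul_apply', Fin.prod_univ_succ (n := d + 1)]
      ring)
    (integrable_prod_mul_exp_quadForm hQ fun j => idx j.succ)
    (fun x _ => hasLineDerivAt_prod_eval (fun j => idx j.succ) x _)
    (fun x _ => by simpa only [hdir] using hasLineDerivAt_exp_quadForm hQsymm x (Q⁻¹ (idx 0)))
  simp only [ContinuousLinearMap.mul_apply', Finset.sum_mul, mul_assoc] at hibp hint
  rw [integral_finsetSum _ fun k _ => hint k] at hibp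
  simp only [integral_const_mul] at hibp
  rw [← neg_inj, ← hibp, ← integral_neg]
  congr 1 with x
  rw [Fin.prod_univ_succ]
  ring

end IntegrationByParts

section Moments

variable {n : ℕ} {Q : Matrix (Fin n) (Fin n) ℝ}

lemma gaussExp_one (hQ : ∀ x : Fin n → ℝ, x ≠ 0 → 0 < quadForm n Q x) :
    gaussExp n Q (fun _ => 1) = 1 := by
  simp only [gaussExp, one_mul]
  exact div_self (integral_exp_pos (integrable_exp_quadForm hQ)).ne'

lemma gaussExp_prod_recursion (hQsymm : Q.IsSymm)
    (hQ : ∀ x : Fin n → ℝ, x ≠ 0 → 0 < quadForm n Q x) (d : ℕ) (idx : Fin (d + 2) → Fin n) :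
    gaussExp n Q (fun x => ∏ j, x (idx j)) = ∑ k : Fin (d + 1), Q⁻¹ (idx 0) (idx k.succ) *
      gaussExp n Q (fun x => ∏ j, x (idx (k.succAbove j).succ)) := by
  simp only [gaussExp, integral_prod_mul_exp_quadForm hQsymm hQ, Finset.sum_div, mul_div_assoc]

lemma gaussExp_prod_eq_zero_of_odd (Q : Matrix (Fin n) (Fin n) ℝ) {d : ℕ} (hd : Odd d)
    (idx : Fin d → Fin n) : gaussExp n Q (fun x => ∏ j, x (idx j)) = 0 := by
  have h := integral_neg_eq_self (fun x : Fin n → ℝ =>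
    (∏ j, x (idx j)) * Real.exp (-(1 / 2) * quadForm n Q x)) volume
  have hodd : ∀ x : Fin n → ℝ, ∏ j, (-x) (idx j) = -∏ j, x (idx j) := fun x => by
    simp [Finset.prod_neg, hd.neg_one_pow]
  have heven : ∀ x : Fin n → ℝ, quadForm n Q (-x) = quadForm n Q x := fun x => by
    simp [quadForm]
  simp only [hodd, heven, neg_mul, integral_neg] at h
  rw [gaussExp, div_eq_zero_iff]
  left
  simp only [neg_mul]
  linarith

end Moments

/-- **Wick's lemma.** For a positive definite symmetric `Q`: odd Gaussian moments vanish;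
the moment of `x_{i₁} ⋯ x_{i_{2m}}` equals
`(1/(2^m m!)) Σ_{σ ∈ S_{2m}} Π_{j=1}^m (Q⁻¹)_{i_{σ(2j-1)} i_{σ(2j)}}` (the sum over perfect
matchings of products of matrix elements of `Q⁻¹`); and in particular
`⟪x_i x_j⟫ = (Q⁻¹)_{ij}`. -/
theorem wick_lemma
    (n : ℕ) (Q : Matrix (Fin n) (Fin n) ℝ) (hQsymm : Q.IsSymm)
    (hQpos : ∀ x : Fin n → ℝ, x ≠ 0 → 0 < quadForm n Q x) :
    (∀ (d : ℕ) (idx : Fin d → Fin n), Odd d →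
        gaussExp n Q (fun x => ∏ j : Fin d, x (idx j)) = 0) ∧
    (∀ m : ℕ, 1 ≤ m → ∀ idx : Fin (2 * m) → Fin n,
        gaussExp n Q (fun x => ∏ j : Fin (2 * m), x (idx j)) =
          (1 / (2 ^ m * (Nat.factorial m) : ℝ)) *
            ∑ σ : Equiv.Perm (Fin (2 * m)), ∏ j : Fin m,
              Q⁻¹ (idx (σ ⟨2 * (j : ℕ), by have := j.isLt; omega⟩))
                  (idx (σ ⟨2 * (j : ℕ) + 1, by have := j.isLt; omega⟩))) ∧
    (∀ i j : Fin n, gaussExp n Q (fun x => x i * x j) = Q⁻¹ i j) := by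
  refine ⟨fun d idx hd => gaussExp_prod_eq_zero_of_odd Q hd idx, fun m _ idx => ?_, fun i j => ?_⟩
  · exact eq_pairingSum_of_recursion (fun i j => Q⁻¹ i j)
      (fun d idx => gaussExp n Q (fun x => ∏ j, x (idx j)))
      (fun idx => by simpa using gaussExp_one hQpos)
      (fun d idx σ => by
        congr 1 with x
        exact Equiv.prod_comp σ fun j => x (idx j))
      (gaussExp_prod_recursion hQsymm hQpos) m idx
  · simpa [gaussExp_one hQpos] using gaussExp_prod_recursion hQsymm hQpos 0 ![i, j]
end
end
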